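/- arXiv:2107.05291 — 3 statements merged into one kernel-verified Lean document; each statement's English description precedes it below -/
import Mathlib

section
/- For every v ∈ ⟨𝐯_J⟩^⊥ with v ≠ v*, setting δ(v) = (√2/ε) ‖v − v*‖, the following local strong convexity inequality holds: ⟨∇H_ε(v), v − v*⟩ ≥ ((1 − exp(−δ(v))) / δ(v)) · (v − v*)^T ∇²H_ε(v*) (v − v*). -/
open MeasureTheory Filter Finset Real Matrix ProbabilityTheory

noncomputable section

namespace SGNOT

variable {𝒳 : Type*} [MeasurableSpace 𝒳]

/-- The function `h_ε(x, v)` from the semi-dual formulation of regularized OT. -/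
def hFun (J : ℕ) (ν : Fin J → ℝ) (c : 𝒳 → Fin J → ℝ) (ε : ℝ)
    (x : 𝒳) (v : Fin J → ℝ) : ℝ :=
  ε + ε * Real.log (∑ j, ν j * Real.exp ((v j - c x j) / ε)) - ∑ j, ν j * v j

/-- The objective function `H_ε(v) = ∫ h_ε(x,v) dμ(x)`. -/
def HFun (J : ℕ) (ν : Fin J → ℝ) (c : 𝒳 → Fin J → ℝ) (ε : ℝ) (μ : Measure 𝒳)
    (v : Fin J → ℝ) : ℝ := ∫ x, hFun J ν c ε x v ∂μ

/-- The vector `π(x, v)`. -/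
def piFun (J : ℕ) (ν : Fin J → ℝ) (c : 𝒳 → Fin J → ℝ) (ε : ℝ)
    (x : 𝒳) (v : Fin J → ℝ) (j : Fin J) : ℝ :=
  ν j * Real.exp ((v j - c x j) / ε) / ∑ k, ν k * Real.exp ((v k - c x k) / ε)

/-- The gradient `∇_v h_ε(x,v) = π(x,v) − ν`. -/
def gradh (J : ℕ) (ν : Fin J → ℝ) (c : 𝒳 → Fin J → ℝ) (ε : ℝ)
    (x : 𝒳) (v : Fin J → ℝ) : Fin J → ℝ :=
  fun j => piFun J ν c ε x v j - ν j

/-- The gradient `∇H_ε(v) = ∫ (π(x,v) − ν) dμ(x)`. -/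
def gradH (J : ℕ) (ν : Fin J → ℝ) (c : 𝒳 → Fin J → ℝ) (ε : ℝ) (μ : Measure 𝒳)
    (v : Fin J → ℝ) : Fin J → ℝ :=
  fun j => ∫ x, (piFun J ν c ε x v j - ν j) ∂μ

/-- The matrix `G_ε(v) = ∫ (π(x,v) − ν)(π(x,v) − ν)^T dμ(x)`. -/
def GMat (J : ℕ) (ν : Fin J → ℝ) (c : 𝒳 → Fin J → ℝ) (ε : ℝ) (μ : Measure 𝒳)
    (v : Fin J → ℝ) : Matrix (Fin J) (Fin J) ℝ :=
  Matrix.of fun i j =>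
    ∫ x, (piFun J ν c ε x v i - ν i) * (piFun J ν c ε x v j - ν j) ∂μ

/-- The Hessian `∇²H_ε(v) = (1/ε) ∫ (diag(π(x,v)) − π(x,v)π(x,v)^T) dμ(x)`. -/
def hessH (J : ℕ) (ν : Fin J → ℝ) (c : 𝒳 → Fin J → ℝ) (ε : ℝ) (μ : Measure 𝒳)
    (v : Fin J → ℝ) : Matrix (Fin J) (Fin J) ℝ :=
  Matrix.of fun i j =>
    ε⁻¹ * ∫ x, ((if i = j then piFun J ν c ε x v i else 0)
      - piFun J ν c ε x v i * piFun J ν c ε x v j) ∂μ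

/-- The orthogonal complement `⟨𝐯_J⟩^⊥` of the span of the constant vector. -/
def perp (J : ℕ) : Set (Fin J → ℝ) := {v | ∑ j, v j = 0}

/-- The orthogonal projection `P_J = I_J − 𝐯_J 𝐯_J^T` onto `⟨𝐯_J⟩^⊥`, as a map. -/
def projPerp (J : ℕ) (v : Fin J → ℝ) : Fin J → ℝ :=
  fun j => v j - (∑ k, v k) / (J : ℝ)

/-- Squared Euclidean norm. -/
def sqnorm {J : ℕ} (v : Fin J → ℝ) : ℝ := ∑ j, (v j) ^ 2

/-- Euclidean norm. -/
def nrm {J : ℕ} (v : Fin J → ℝ) : ℝ := Real.sqrt (sqnorm v)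

/-- Squared Frobenius norm. -/
def frobSq {J : ℕ} (A : Matrix (Fin J) (Fin J) ℝ) : ℝ := ∑ i, ∑ j, (A i j) ^ 2

/-- Frobenius norm. -/
def frob {J : ℕ} (A : Matrix (Fin J) (Fin J) ℝ) : ℝ := Real.sqrt (frobSq A)

/-- `min(ν)`. -/
def minNu (J : ℕ) (ν : Fin J → ℝ) : ℝ := sInf (Set.range ν)

/-- `max(ν)`. -/
def maxNu (J : ℕ) (ν : Fin J → ℝ) : ℝ := sSup (Set.range ν)

/-- The deterministic regularization vector `Z_n = √(ν_{ℓ_n}) e_{ℓ_n}`,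
`ℓ_n = 1 + ((n−1) mod J)` (one-based), i.e. index `(n−1) mod J` (zero-based). -/
def Zvec (J : ℕ) (ν : Fin J → ℝ) (n : ℕ) : Fin J → ℝ :=
  fun j => if (j : ℕ) = (n - 1) % J then Real.sqrt (ν j) else 0

/-- Smallest Rayleigh quotient of `A` over nonzero vectors of `⟨𝐯_J⟩^⊥`. -/
def lamPerp (J : ℕ) (A : Matrix (Fin J) (Fin J) ℝ) : ℝ :=
  sInf {r : ℝ | ∃ w ∈ perp J, w ≠ 0 ∧ r = (w ⬝ᵥ A.mulVec w) / sqnorm w}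

/-- Smallest eigenvalue of a symmetric matrix, as smallest Rayleigh quotient. -/
def lamMin (J : ℕ) (A : Matrix (Fin J) (Fin J) ℝ) : ℝ :=
  sInf {r : ℝ | ∃ w : Fin J → ℝ, w ≠ 0 ∧ r = (w ⬝ᵥ A.mulVec w) / sqnorm w}

/-- Largest eigenvalue of a symmetric matrix, as largest Rayleigh quotient. -/
def lamMax (J : ℕ) (A : Matrix (Fin J) (Fin J) ℝ) : ℝ :=
  sSup {r : ℝ | ∃ w : Fin J → ℝ, w ≠ 0 ∧ r = (w ⬝ᵥ A.mulVec w) / sqnorm w}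


/-- `P_J = I_J − 𝐯_J 𝐯_J^T`. -/
def PJmat (J : ℕ) : Matrix (Fin J) (Fin J) ℝ :=
  1 - Matrix.vecMulVec (fun _ => (Real.sqrt J)⁻¹) (fun _ => (Real.sqrt J)⁻¹)

/-- `H̃_ε(u) = H_ε(G_*^{−1/2} u) − H_ε(v*)`. -/
def Htil (J : ℕ) (ν : Fin J → ℝ) (c : 𝒳 → Fin J → ℝ) (ε : ℝ) (μ : Measure 𝒳)
    (Ginvsqrt : Matrix (Fin J) (Fin J) ℝ) (vstar u : Fin J → ℝ) : ℝ :=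
  HFun J ν c ε μ (Ginvsqrt.mulVec u) - HFun J ν c ε μ vstar

/-- `∇H̃_ε(u) = G_*^{−1/2} ∇H_ε(G_*^{−1/2} u)`. -/
def gradHtil (J : ℕ) (ν : Fin J → ℝ) (c : 𝒳 → Fin J → ℝ) (ε : ℝ) (μ : Measure 𝒳)
    (Ginvsqrt : Matrix (Fin J) (Fin J) ℝ) (u : Fin J → ℝ) : Fin J → ℝ :=
  Ginvsqrt.mulVec (gradH J ν c ε μ (Ginvsqrt.mulVec u))

/-- `∇²H̃_ε(u) = G_*^{−1/2} ∇²H_ε(G_*^{−1/2} u) G_*^{−1/2}`. -/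
def hessHtil (J : ℕ) (ν : Fin J → ℝ) (c : 𝒳 → Fin J → ℝ) (ε : ℝ) (μ : Measure 𝒳)
    (Ginvsqrt : Matrix (Fin J) (Fin J) ℝ) (u : Fin J → ℝ) : Matrix (Fin J) (Fin J) ℝ :=
  Ginvsqrt * hessH J ν c ε μ (Ginvsqrt.mulVec u) * Ginvsqrt

/-- The Lyapunov function `Φ(u) = H̃_ε(u) exp(H̃_ε(u))`. -/
def PhiFun (J : ℕ) (ν : Fin J → ℝ) (c : 𝒳 → Fin J → ℝ) (ε : ℝ) (μ : Measure 𝒳)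
    (Ginvsqrt : Matrix (Fin J) (Fin J) ℝ) (vstar u : Fin J → ℝ) : ℝ :=
  Htil J ν c ε μ Ginvsqrt vstar u * Real.exp (Htil J ν c ε μ Ginvsqrt vstar u)

/-- The KL constant `m_ε = ε λ_⊥ min(1, ε/4)`. -/
def mEps (J : ℕ) (ν : Fin J → ℝ) (c : 𝒳 → Fin J → ℝ) (ε : ℝ) (μ : Measure 𝒳)
    (vstar : Fin J → ℝ) : ℝ :=
  ε * lamPerp J (GMat J ν c ε μ vstar) * min 1 (ε / 4)

/-- Exponential moments. -/
def Smom {J : ℕ} (w a : Fin J → ℝ) (k : ℕ) (t : ℝ) : ℝ :=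
  ∑ i, w i * Real.exp (t * a i) * a i ^ k

lemma Smom_deriv {J : ℕ} (w a : Fin J → ℝ) (k : ℕ) (t : ℝ) :
    HasDerivAt (Smom w a k) (Smom w a (k + 1) t) t := by
  unfold Smom
  have h : ∀ i ∈ (Finset.univ : Finset (Fin J)),
      HasDerivAt (fun t => w i * Real.exp (t * a i) * a i ^ k)
        (w i * Real.exp (t * a i) * a i ^ (k + 1)) t := by
    intro i _
    have h1 : HasDerivAt (fun t : ℝ => t * a i) (a i) t := by
      simpa using (hasDerivAt_id t).mul_const (a i)
    refine ((h1.exp.const_mul (w i)).mul_const (a i ^ k)).congr_deriv ?_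
    ring
  exact HasDerivAt.fun_sum h

lemma Smom_pos {J : ℕ} (hJ : 0 < J) (w a : Fin J → ℝ) (hw : ∀ i, 0 < w i) (t : ℝ) :
    0 < Smom w a 0 t := by
  unfold Smom
  have : Nonempty (Fin J) := ⟨⟨0, hJ⟩⟩
  apply Finset.sum_pos _ Finset.univ_nonempty
  intro i _
  have := hw i
  positivity

lemma third_ge {J : ℕ} (hJ : 0 < J) (w a : Fin J → ℝ) (hw : ∀ i, 0 < w i) (δ : ℝ)
    (ha : ∀ i j, a i - a j ≤ δ) (t : ℝ) :
    0 ≤ Smom w a 3 t / Smom w a 0 t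
        - 3 * (Smom w a 1 t / Smom w a 0 t) * (Smom w a 2 t / Smom w a 0 t)
        + 2 * (Smom w a 1 t / Smom w a 0 t) ^ 3
      + δ * (Smom w a 2 t / Smom w a 0 t - (Smom w a 1 t / Smom w a 0 t) ^ 2) := by
  have h0 := Smom_pos hJ w a hw t
  set m := Smom w a 1 t / Smom w a 0 t with hm
  have hm1 : Smom w a 1 t = m * Smom w a 0 t := by rw [hm]; field_simp
  have hmle : ∀ i, m ≤ a i + δ := by
    intro i
    rw [hm, div_le_iff₀ h0]
    unfold Smom
    rw [Finset.mul_sum]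
    apply Finset.sum_le_sum
    intro j _
    have h1 : a j ≤ a i + δ := by linarith [ha j i]
    have h2 : 0 < w j * Real.exp (t * a j) := mul_pos (hw j) (Real.exp_pos _)
    nlinarith
  have hsum : 0 ≤ ∑ i, w i * Real.exp (t * a i) * ((a i - m) ^ 2 * (a i + δ - m)) := by
    apply Finset.sum_nonneg
    intro i _
    have h2 : 0 < w i * Real.exp (t * a i) := mul_pos (hw i) (Real.exp_pos _)
    exact mul_nonneg h2.le (mul_nonneg (sq_nonneg _) (by linarith [hmle i]))
  have hexp : ∑ i, w i * Real.exp (t * a i) * ((a i - m) ^ 2 * (a i + δ - m))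
      = Smom w a 3 t + (δ - 3 * m) * Smom w a 2 t + (3 * m ^ 2 - 2 * m * δ) * Smom w a 1 t
        + (m ^ 2 * δ - m ^ 3) * Smom w a 0 t := by
    unfold Smom
    simp only [Finset.mul_sum, ← Finset.sum_add_distrib]
    apply Finset.sum_congr rfl
    intro i _
    ring
  rw [hexp] at hsum
  have := div_nonneg hsum h0.le
  refine this.trans (le_of_eq ?_)
  rw [hm1]
  field_simp
  ring

lemma key {J : ℕ} (hJ : 0 < J) (w a : Fin J → ℝ) (hw : ∀ i, 0 < w i) (δ : ℝ) (hδ : 0 < δ)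
    (ha : ∀ i j, a i - a j ≤ δ) :
    (1 - Real.exp (-δ)) / δ *
        (Smom w a 2 0 / Smom w a 0 0 - (Smom w a 1 0 / Smom w a 0 0) ^ 2)
      ≤ Smom w a 1 1 / Smom w a 0 1 - Smom w a 1 0 / Smom w a 0 0 := by
  have h0 := Smom_pos hJ w a hw
  set V : ℝ → ℝ := fun t => Smom w a 2 t / Smom w a 0 t - (Smom w a 1 t / Smom w a 0 t) ^ 2
    with hV
  have hM : ∀ k t, HasDerivAt (fun t => Smom w a k t / Smom w a 0 t)
      (Smom w a (k+1) t / Smom w a 0 t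
        - Smom w a k t / Smom w a 0 t * (Smom w a 1 t / Smom w a 0 t)) t := by
    intro k t
    have := (h0 t).ne'
    refine ((Smom_deriv w a k t).div (Smom_deriv w a 0 t) (h0 t).ne').congr_deriv ?_
    rw [zero_add]
    field_simp
  have hVd : ∀ t, HasDerivAt V (Smom w a 3 t / Smom w a 0 t
        - 3 * (Smom w a 1 t / Smom w a 0 t) * (Smom w a 2 t / Smom w a 0 t)
        + 2 * (Smom w a 1 t / Smom w a 0 t) ^ 3) t := by
    intro t
    refine ((hM 2 t).sub ((hM 1 t).pow 2)).congr_deriv ?_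
    norm_num
    ring
  have hE : ∀ t, HasDerivAt (fun t => Real.exp (δ * t)) (Real.exp (δ * t) * δ) t := by
    intro t
    have h1 : HasDerivAt (fun t : ℝ => δ * t) δ t := by
      simpa using (hasDerivAt_id t).const_mul δ
    exact h1.exp
  have hmono : Monotone (fun t => V t * Real.exp (δ * t)) := by
    apply monotone_of_hasDerivAt_nonneg (fun t => (hVd t).mul (hE t))
    intro t
    have := mul_nonneg (third_ge hJ w a hw δ ha t) (Real.exp_pos (δ * t)).le
    simp only [hV, Pi.zero_apply]
    linarith
  have hVt : ∀ t, 0 ≤ t → V 0 * Real.exp (-(δ * t)) ≤ V t := by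
    intro t ht
    have h1 := hmono ht
    simp only [mul_zero, Real.exp_zero, mul_one] at h1
    rw [Real.exp_neg, ← div_eq_mul_inv, div_le_iff₀ (Real.exp_pos _)]
    exact h1
  have hF : ∀ t, HasDerivAt (fun t => Smom w a 1 t / Smom w a 0 t
      - (1 - Real.exp (-(δ * t))) / δ * V 0) (V t - V 0 * Real.exp (-(δ * t))) t := by
    intro t
    have h1 : HasDerivAt (fun t : ℝ => -(δ * t)) (-δ) t := by
      simpa using (hasDerivAt_id t).const_mul (-δ)
    refine ((hM 1 t).sub (((h1.exp.const_sub 1).div_const δ).mul_const (V 0))).congr_deriv ?_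
    simp only [hV]
    field_simp
  have hmon2 : MonotoneOn (fun t => Smom w a 1 t / Smom w a 0 t
      - (1 - Real.exp (-(δ * t))) / δ * V 0) (Set.Ici 0) := by
    apply monotoneOn_of_deriv_nonneg (convex_Ici 0)
    · exact fun t _ => (hF t).continuousAt.continuousWithinAt
    · exact fun t _ => (hF t).differentiableAt.differentiableWithinAt
    · intro t ht
      rw [interior_Ici] at ht
      rw [(hF t).deriv]
      linarith [hVt t (le_of_lt ht)]
  have := hmon2 (Set.mem_Ici.2 le_rfl) (Set.mem_Ici.2 zero_le_one) zero_le_one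
  simp only [mul_zero, neg_zero, Real.exp_zero, sub_self, zero_div, zero_mul, sub_zero,
    mul_one] at this
  linarith

lemma nrm_bound {J : ℕ} (d : Fin J → ℝ) (i j : Fin J) : d i - d j ≤ Real.sqrt 2 * nrm d := by
  unfold nrm
  rw [← Real.sqrt_mul (by norm_num)]
  apply Real.le_sqrt_of_sq_le
  by_cases h : i = j
  · subst h
    have : 0 ≤ sqnorm d := Finset.sum_nonneg fun i _ => sq_nonneg _
    simp [this]
  · have h1 : d i ^ 2 + d j ^ 2 ≤ sqnorm d := by
      rw [← Finset.sum_pair (f := fun i => d i ^ 2) h]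
      exact Finset.sum_le_sum_of_subset_of_nonneg (Finset.subset_univ _)
        fun i _ _ => sq_nonneg _
    nlinarith [sq_nonneg (d i + d j)]

section
variable (J : ℕ) (hJ : 0 < J) (ν : Fin J → ℝ) (hν : ∀ j, 0 < ν j) (c : 𝒳 → Fin J → ℝ) (ε : ℝ)

lemma den_pos (hJ : 0 < J) (hν : ∀ j, 0 < ν j) (x : 𝒳) (v : Fin J → ℝ) :
    0 < ∑ k, ν k * Real.exp ((v k - c x k) / ε) := by
  have : Nonempty (Fin J) := ⟨⟨0, hJ⟩⟩
  apply Finset.sum_pos _ Finset.univ_nonempty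
  intro i _
  have := hν i
  positivity

lemma pi_nonneg (hJ : 0 < J) (hν : ∀ j, 0 < ν j) (x : 𝒳) (v : Fin J → ℝ) (j : Fin J) :
    0 ≤ piFun J ν c ε x v j := by
  have := den_pos J ν c ε hJ hν x v
  have := hν j
  unfold piFun
  positivity

lemma pi_le_one (hJ : 0 < J) (hν : ∀ j, 0 < ν j) (x : 𝒳) (v : Fin J → ℝ) (j : Fin J) :
    piFun J ν c ε x v j ≤ 1 := by
  have := den_pos J ν c ε hJ hν x v
  unfold piFun
  rw [div_le_one this]
  exact Finset.single_le_sum (f := fun k => ν k * Real.exp ((v k - c x k) / ε))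
    (fun k _ => mul_nonneg (hν k).le (Real.exp_pos _).le) (Finset.mem_univ j)

lemma pi_meas (hc : ∀ j, Measurable fun x => c x j) (v : Fin J → ℝ) (j : Fin J) :
    Measurable fun x => piFun J ν c ε x v j := by
  unfold piFun
  fun_prop

lemma h_meas (hc : ∀ j, Measurable fun x => c x j) (v : Fin J → ℝ) :
    Measurable fun x => hFun J ν c ε x v := by
  unfold hFun
  fun_prop

lemma pi_int (hJ : 0 < J) (hν : ∀ j, 0 < ν j) (hc : ∀ j, Measurable fun x => c x j)
    (μ : Measure 𝒳) [IsProbabilityMeasure μ] (v : Fin J → ℝ) (j : Fin J) :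
    Integrable (fun x => piFun J ν c ε x v j) μ := by
  apply Integrable.of_bound (pi_meas J ν c ε hc v j).aestronglyMeasurable 1
  refine Eventually.of_forall fun x => ?_
  rw [Real.norm_eq_abs, abs_of_nonneg (pi_nonneg J ν c ε hJ hν x v j)]
  exact pi_le_one J ν c ε hJ hν x v j

lemma pipi_int (hJ : 0 < J) (hν : ∀ j, 0 < ν j) (hc : ∀ j, Measurable fun x => c x j)
    (μ : Measure 𝒳) [IsProbabilityMeasure μ] (v : Fin J → ℝ) (i j : Fin J) :
    Integrable (fun x => piFun J ν c ε x v i * piFun J ν c ε x v j) μ := by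
  apply Integrable.of_bound ((pi_meas J ν c ε hc v i).mul
    (pi_meas J ν c ε hc v j)).aestronglyMeasurable 1
  refine Eventually.of_forall fun x => ?_
  have h1 := pi_nonneg J ν c ε hJ hν x v i
  have h2 := pi_nonneg J ν c ε hJ hν x v j
  rw [Pi.mul_apply, Real.norm_eq_abs, abs_of_nonneg (mul_nonneg h1 h2)]
  exact mul_le_one₀ (pi_le_one J ν c ε hJ hν x v i) h2 (pi_le_one J ν c ε hJ hν x v j)

lemma h_int (hJ : 0 < J) (hν : ∀ j, 0 < ν j) (hε : 0 < ε) (hc : ∀ j, Measurable fun x => c x j)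
    (hc0 : ∀ x j, 0 ≤ c x j)
    (μ : Measure 𝒳) [IsProbabilityMeasure μ] (hci : ∀ j, Integrable (fun x => c x j) μ)
    (v : Fin J → ℝ) :
    Integrable (fun x => hFun J ν c ε x v) μ := by
  set i0 : Fin J := ⟨0, hJ⟩
  have hlog : Integrable
      (fun x => Real.log (∑ j, ν j * Real.exp ((v j - c x j) / ε))) μ := by
    refine Integrable.mono' (g := fun x => |Real.log (∑ j, ν j * Real.exp (v j / ε))|
      + (|Real.log (ν i0)| + |v i0 / ε| + c x i0 / ε)) ?_ ?_ ?_
    · have := (hci i0).div_const ε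
      fun_prop
    · apply Measurable.aestronglyMeasurable
      fun_prop
    · refine Eventually.of_forall fun x => ?_
      have hd := den_pos J ν c ε hJ hν x v
      have hup : Real.log (∑ j, ν j * Real.exp ((v j - c x j) / ε))
          ≤ Real.log (∑ j, ν j * Real.exp (v j / ε)) := by
        apply Real.log_le_log hd
        apply Finset.sum_le_sum
        intro j _
        have := hν j
        have := hc0 x j
        gcongr
        linarith
      have hlo : Real.log (ν i0) + (v i0 - c x i0) / ε
          ≤ Real.log (∑ j, ν j * Real.exp ((v j - c x j) / ε)) := by
        rw [← Real.log_exp ((v i0 - c x i0) / ε),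
          ← Real.log_mul (hν i0).ne' (Real.exp_pos _).ne']
        apply Real.log_le_log (mul_pos (hν i0) (Real.exp_pos _))
        exact Finset.single_le_sum (f := fun k => ν k * Real.exp ((v k - c x k) / ε))
          (fun k _ => mul_nonneg (hν k).le (Real.exp_pos _).le) (Finset.mem_univ i0)
      have hcc : 0 ≤ c x i0 / ε := div_nonneg (hc0 x i0) hε.le
      rw [sub_div] at hlo
      rw [Real.norm_eq_abs, abs_le]
      constructor
      · linarith [neg_abs_le (Real.log (ν i0)), neg_abs_le (v i0 / ε),
          abs_nonneg (Real.log (∑ j, ν j * Real.exp (v j / ε)))]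
      · linarith [le_abs_self (Real.log (∑ j, ν j * Real.exp (v j / ε))),
          abs_nonneg (Real.log (ν i0)), abs_nonneg (v i0 / ε)]
  unfold hFun
  exact ((integrable_const _).add (hlog.const_mul ε)).sub (integrable_const _)

lemma h_deriv (hJ : 0 < J) (hν : ∀ j, 0 < ν j) (hε : 0 < ε) (x : 𝒳) (v d : Fin J → ℝ) (t : ℝ) :
    HasDerivAt (fun t : ℝ => hFun J ν c ε x (v + t • d))
      (∑ j, (piFun J ν c ε x (v + t • d) j - ν j) * d j) t := by
  have hd := den_pos J ν c ε hJ hν x (v + t • d)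
  have hlin : ∀ j, HasDerivAt (fun t : ℝ => (v + t • d) j) (d j) t := by
    intro j
    simpa using ((hasDerivAt_id t).mul_const (d j)).const_add (v j)
  have hS : HasDerivAt (fun t : ℝ => ∑ j, ν j * Real.exp (((v + t • d) j - c x j) / ε))
      (∑ j, ν j * (Real.exp (((v + t • d) j - c x j) / ε) * (d j / ε))) t := by
    apply HasDerivAt.fun_sum
    intro j _
    exact ((((hlin j).sub_const (c x j)).div_const ε).exp).const_mul (ν j)
  have hL : HasDerivAt (fun t : ℝ => ∑ j, ν j * (v + t • d) j) (∑ j, ν j * d j) t := by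
    apply HasDerivAt.fun_sum
    intro j _
    exact (hlin j).const_mul (ν j)
  unfold hFun
  refine ((((hS.log hd.ne').const_mul ε).const_add ε).sub hL).congr_deriv ?_
  symm
  simp only [sub_mul, Finset.sum_sub_distrib]
  congr 1
  rw [Finset.sum_div, Finset.mul_sum]
  apply Finset.sum_congr rfl
  intro j _
  unfold piFun
  field_simp

lemma gradH_dot (hJ : 0 < J) (hν : ∀ j, 0 < ν j) (hc : ∀ j, Measurable fun x => c x j)
    (μ : Measure 𝒳) [IsProbabilityMeasure μ] (v d : Fin J → ℝ) :
    gradH J ν c ε μ v ⬝ᵥ d = ∫ x, ∑ j, (piFun J ν c ε x v j - ν j) * d j ∂μ := by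
  rw [integral_finsetSum]
  · simp only [dotProduct, gradH, integral_mul_const]
  · intro j _
    exact ((pi_int J ν c ε hJ hν hc μ v j).sub (integrable_const _)).mul_const _

lemma hess_dot (hJ : 0 < J) (hν : ∀ j, 0 < ν j) (hc : ∀ j, Measurable fun x => c x j)
    (μ : Measure 𝒳) [IsProbabilityMeasure μ] (v d : Fin J → ℝ) :
    d ⬝ᵥ (hessH J ν c ε μ v).mulVec d
      = ∫ x, ε⁻¹ * (∑ j, piFun J ν c ε x v j * d j ^ 2
          - (∑ j, piFun J ν c ε x v j * d j) ^ 2) ∂μ := by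
  have hint : ∀ i j, Integrable (fun x => ((if i = j then piFun J ν c ε x v i else 0)
      - piFun J ν c ε x v i * piFun J ν c ε x v j)) μ := by
    intro i j
    refine Integrable.sub ?_ (pipi_int J ν c ε hJ hν hc μ v i j)
    by_cases h : i = j
    · simpa [h] using pi_int J ν c ε hJ hν hc μ v j
    · simp [h]
  have hpt : ∀ x, ε⁻¹ * (∑ j, piFun J ν c ε x v j * d j ^ 2
          - (∑ j, piFun J ν c ε x v j * d j) ^ 2)
      = ∑ i, ∑ j, (ε⁻¹ * d i * d j) * ((if i = j then piFun J ν c ε x v i else 0)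
      - piFun J ν c ε x v i * piFun J ν c ε x v j) := by
    intro x
    simp only [mul_sub, Finset.sum_sub_distrib, mul_ite, mul_zero, Finset.sum_ite_eq,
      Finset.mem_univ, if_true]
    rw [sq, Finset.sum_mul_sum, Finset.mul_sum, Finset.mul_sum]
    congr 1
    · exact Finset.sum_congr rfl fun i _ => by ring
    · refine Finset.sum_congr rfl fun i _ => ?_
      rw [Finset.mul_sum]
      exact Finset.sum_congr rfl fun j _ => by ring
  simp only [hpt]
  rw [integral_finsetSum _ fun i _ => integrable_finsetSum _ fun j _ => (hint i j).const_mul _]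
  simp only [dotProduct, mulVec, hessH, Matrix.of_apply]
  refine Finset.sum_congr rfl fun i _ => ?_
  rw [integral_finsetSum _ fun j _ => (hint i j).const_mul _, Finset.mul_sum]
  refine Finset.sum_congr rfl fun j _ => ?_
  rw [integral_const_mul]
  ring

lemma grad_star_zero (hJ : 0 < J) (hν : ∀ j, 0 < ν j) (hε : 0 < ε)
    (hc : ∀ j, Measurable fun x => c x j) (hc0 : ∀ x j, 0 ≤ c x j)
    (μ : Measure 𝒳) [IsProbabilityMeasure μ] (hci : ∀ j, Integrable (fun x => c x j) μ)
    (vstar d : Fin J → ℝ) (hvs : vstar ∈ perp J) (hd : d ∈ perp J)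
    (hmin : ∀ v ∈ perp J, HFun J ν c ε μ vstar ≤ HFun J ν c ε μ v) :
    gradH J ν c ε μ vstar ⬝ᵥ d = 0 := by
  have hder := (hasDerivAt_integral_of_dominated_loc_of_deriv_le (μ := μ)
    (F := fun t x => hFun J ν c ε x (vstar + t • d))
    (F' := fun t x => ∑ j, (piFun J ν c ε x (vstar + t • d) j - ν j) * d j)
    (x₀ := (0 : ℝ)) (s := Set.univ) (bound := fun _ => ∑ j, (1 + ν j) * |d j|)
    Filter.univ_mem
    (Eventually.of_forall fun t => (h_meas J ν c ε hc _).aestronglyMeasurable)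
    (h_int J ν c ε hJ hν hε hc hc0 μ hci _)
    (by
      apply Measurable.aestronglyMeasurable
      have := pi_meas J ν c ε hc (vstar + (0 : ℝ) • d)
      fun_prop)
    (by
      refine Eventually.of_forall fun x t _ => ?_
      refine (norm_sum_le _ _).trans (Finset.sum_le_sum fun j _ => ?_)
      rw [norm_mul, Real.norm_eq_abs, Real.norm_eq_abs]
      refine mul_le_mul_of_nonneg_right ?_ (abs_nonneg _)
      rw [abs_le]
      have h1 := pi_nonneg J ν c ε hJ hν x (vstar + t • d) j
      have h2 := pi_le_one J ν c ε hJ hν x (vstar + t • d) j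
      have h3 := hν j
      constructor <;> linarith)
    (integrable_const _)
    (Eventually.of_forall fun x t _ => h_deriv J ν c ε hJ hν hε x vstar d t)).2
  have hlm : IsLocalMin (fun t : ℝ => ∫ x, hFun J ν c ε x (vstar + t • d) ∂μ) 0 := by
    refine Eventually.of_forall fun t => ?_
    have hmem : vstar + t • d ∈ perp J := by
      simp only [perp, Set.mem_ofPred_eq] at *
      simp [Finset.sum_add_distrib, ← Finset.mul_sum, hvs, hd]
    simpa [HFun] using hmin _ hmem
  have := hlm.hasDerivAt_eq_zero hder
  rw [gradH_dot J ν c ε hJ hν hc μ vstar d]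
  simpa using this

lemma pointwise (hJ : 0 < J) (hν : ∀ j, 0 < ν j) (hε : 0 < ε) (x : 𝒳) (v vs : Fin J → ℝ)
    (δ : ℝ) (hδ : 0 < δ) (hr : ∀ i j, (v - vs) i / ε - (v - vs) j / ε ≤ δ) :
    (1 - Real.exp (-δ)) / δ * (ε⁻¹ * (∑ j, piFun J ν c ε x vs j * (v - vs) j ^ 2
          - (∑ j, piFun J ν c ε x vs j * (v - vs) j) ^ 2))
      ≤ ∑ j, (piFun J ν c ε x v j - ν j) * (v - vs) j
        - ∑ j, (piFun J ν c ε x vs j - ν j) * (v - vs) j := by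
  set w : Fin J → ℝ := fun j => ν j * Real.exp ((vs j - c x j) / ε) with hw
  set a : Fin J → ℝ := fun j => (v - vs) j / ε with ha
  have hk := key hJ w a (fun i => mul_pos (hν i) (Real.exp_pos _)) δ hδ hr
  have hwe : ∀ j, w j * Real.exp (1 * a j) = ν j * Real.exp ((v j - c x j) / ε) := by
    intro j
    simp only [hw, ha, mul_assoc, ← Real.exp_add, Pi.sub_apply]
    congr 2
    ring
  have hd : ∀ j, (v - vs) j = ε * a j := by
    intro j
    simp only [ha]
    field_simp
  have e0 : ∀ k, Smom w a k 0 / Smom w a 0 0 = ∑ j, piFun J ν c ε x vs j * a j ^ k := by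
    intro k
    simp [Smom, piFun, hw, Finset.sum_div, div_mul_eq_mul_div]
  have e1 : ∀ k, Smom w a k 1 / Smom w a 0 1 = ∑ j, piFun J ν c ε x v j * a j ^ k := by
    intro k
    simp only [Smom, hwe, pow_zero, mul_one]
    simp [piFun, Finset.sum_div, div_mul_eq_mul_div]
  rw [e0, e0, e1] at hk
  have hk2 := mul_le_mul_of_nonneg_left hk hε.le
  have l1 : ∑ j, piFun J ν c ε x vs j * (v - vs) j ^ 2
      = ε ^ 2 * ∑ j, piFun J ν c ε x vs j * a j ^ 2 := by
    rw [Finset.mul_sum]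
    exact Finset.sum_congr rfl fun j _ => by rw [hd]; ring
  have l2 : ∀ u, ∑ j, piFun J ν c ε x u j * (v - vs) j
      = ε * ∑ j, piFun J ν c ε x u j * a j ^ 1 := by
    intro u
    rw [Finset.mul_sum]
    exact Finset.sum_congr rfl fun j _ => by rw [hd]; ring
  simp only [sub_mul, Finset.sum_sub_distrib]
  rw [l1, l2, l2]
  refine le_of_eq_of_le ?_ (hk2.trans_eq ?_)
  · field_simp
  · ring

end

theorem stmt_14
    {𝒳 : Type*} [MeasurableSpace 𝒳]
    (J : ℕ) (hJ : 0 < J)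
    (ν : Fin J → ℝ) (hν : ∀ j, 0 < ν j) (hνsum : ∑ j, ν j = 1)
    (μ : Measure 𝒳) [IsProbabilityMeasure μ]
    (c : 𝒳 → Fin J → ℝ) (hc_meas : ∀ j, Measurable fun x => c x j)
    (hc_nonneg : ∀ x j, 0 ≤ c x j)
    (hc_int : ∀ j, Integrable (fun x => c x j) μ)
    (ε : ℝ) (hε : 0 < ε)
    (vstar : Fin J → ℝ) (hvstar : vstar ∈ perp J)
    (hmin : ∀ v ∈ perp J, HFun J ν c ε μ vstar ≤ HFun J ν c ε μ v)
    :
    ∀ v ∈ perp J, v ≠ vstar →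
      ((1 - Real.exp (-(Real.sqrt 2 / ε * nrm (v - vstar))))
            / (Real.sqrt 2 / ε * nrm (v - vstar))) *
          ((v - vstar) ⬝ᵥ (hessH J ν c ε μ vstar).mulVec (v - vstar))
        ≤ gradH J ν c ε μ v ⬝ᵥ (v - vstar) := by
  intro v hv hne
  set d := v - vstar with hd
  set δ := Real.sqrt 2 / ε * nrm d with hδdef
  have hdp : d ∈ perp J := by
    simp only [perp, Set.mem_ofPred_eq] at *
    simp [hd, Finset.sum_sub_distrib, hv, hvstar]
  have hn : 0 < nrm d := by
    apply Real.sqrt_pos.2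
    obtain ⟨i, hi⟩ := Function.ne_iff.1 hne
    exact Finset.sum_pos' (fun i _ => sq_nonneg _)
      ⟨i, Finset.mem_univ i, by have := sub_ne_zero.2 hi; exact sq_pos_of_ne_zero this⟩
  have hδ : 0 < δ := by positivity
  have hr : ∀ i j, d i / ε - d j / ε ≤ δ := by
    intro i j
    rw [← sub_div, hδdef, div_mul_eq_mul_div]
    exact div_le_div_of_nonneg_right (nrm_bound d i j) hε.le
  have hz := grad_star_zero J ν c ε hJ hν hε hc_meas hc_nonneg μ hc_int vstar d hvstar hdp hmin
  have hgi : ∀ u, Integrable (fun x => ∑ j, (piFun J ν c ε x u j - ν j) * d j) μ := fun u =>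
    integrable_finsetSum _ fun j _ =>
      ((pi_int J ν c ε hJ hν hc_meas μ u j).sub (integrable_const _)).mul_const _
  rw [gradH_dot J ν c ε hJ hν hc_meas μ] at hz ⊢
  rw [hess_dot J ν c ε hJ hν hc_meas μ, ← integral_const_mul, 
    ← sub_zero (∫ x, ∑ j, (piFun J ν c ε x v j - ν j) * d j ∂μ), ← hz]
  rw [← integral_sub (hgi v) (hgi vstar)]
  refine integral_mono ?_ ((hgi v).sub (hgi vstar))
    fun x => pointwise J ν c ε hJ hν hε x v vstar δ hδ hr
  refine Integrable.const_mul (Integrable.const_mul (Integrable.sub ?_ ?_) _) _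
  · exact integrable_finsetSum _ fun j _ => (pi_int J ν c ε hJ hν hc_meas μ vstar j).mul_const _
  · simp only [sq, Finset.sum_mul_sum]
    refine integrable_finsetSum _ fun i _ => integrable_finsetSum _ fun j _ => ?_
    refine ((pipi_int J ν c ε hJ hν hc_meas μ vstar i j).mul_const (d i * d j)).congr
      (Eventually.of_forall fun x => ?_)
    simp only
    ring

end SGNOT

end
end

section
/- For every v ∈ ⟨𝐯_J⟩^⊥ the matrix G_ε(v) − G_ε(v*) satisfies the two-sided Loewner bound −(4/ε) ‖v − v*‖ I_J ≤ G_ε(v) − G_ε(v*) ≤ (4/ε) ‖v − v*‖ I_J; equivalently, | u^T (G_ε(v) − G_ε(v*)) u | ≤ (4/ε) ‖v − v*‖ ‖u‖² for all u ∈ ℝ^J. -/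
open MeasureTheory Filter Finset Real Matrix ProbabilityTheory

noncomputable section

namespace SGNOT

variable {𝒳 : Type*} [MeasurableSpace 𝒳]

theorem aux_sq_le {J : ℕ} (p : Fin J → ℝ) (hp0 : ∀ j, 0 ≤ p j) (hp1 : ∑ j, p j = 1)
    (u : Fin J → ℝ) : ∑ j, p j * u j ^ 2 ≤ sqnorm u := by
  unfold sqnorm
  refine Finset.sum_le_sum fun j _ => ?_
  have h1 : p j ≤ 1 := by
    rw [← hp1]
    exact Finset.single_le_sum (fun i _ => hp0 i) (Finset.mem_univ j)
  nlinarith [sq_nonneg (u j)]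

theorem aux_nrm_sq {J : ℕ} (u : Fin J → ℝ) : nrm u ^ 2 = sqnorm u :=
  Real.sq_sqrt (Finset.sum_nonneg fun j _ => sq_nonneg (u j))

theorem aux_nrm_nonneg {J : ℕ} (u : Fin J → ℝ) : 0 ≤ nrm u := Real.sqrt_nonneg _

theorem aux_expand {J : ℕ} (p u : Fin J → ℝ) (m : ℝ) :
    ∑ j, p j * (u j - m) ^ 2 = ∑ j, p j * u j ^ 2 - 2 * m * ∑ j, u j * p j
      + m ^ 2 * ∑ j, p j := by
  rw [Finset.mul_sum, Finset.mul_sum, ← Finset.sum_sub_distrib, ← Finset.sum_add_distrib]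
  exact Finset.sum_congr rfl fun j _ => by ring

theorem aux_mean {J : ℕ} (p : Fin J → ℝ) (hp0 : ∀ j, 0 ≤ p j) (hp1 : ∑ j, p j = 1)
    (u : Fin J → ℝ) : |∑ j, u j * p j| ≤ nrm u := by
  have h2 := aux_sq_le p hp0 hp1 u
  apply abs_le_of_sq_le_sq _ (aux_nrm_nonneg u)
  rw [aux_nrm_sq]
  refine le_trans ?_ h2
  have h : 0 ≤ ∑ j, p j * (u j - ∑ k, u k * p k) ^ 2 :=
    Finset.sum_nonneg fun j _ => mul_nonneg (hp0 j) (sq_nonneg _)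
  set m := ∑ k, u k * p k with hm
  have e : ∑ j, p j * (u j - m) ^ 2 = ∑ j, p j * u j ^ 2 - 2 * m * ∑ j, u j * p j
      + m ^ 2 * ∑ j, p j := aux_expand p u m
  rw [e, hp1, ← hm] at h
  nlinarith

theorem aux_cov {J : ℕ} (p : Fin J → ℝ) (hp0 : ∀ j, 0 ≤ p j) (hp1 : ∑ j, p j = 1)
    (u w : Fin J → ℝ) :
    |∑ j, u j * w j * p j - (∑ j, u j * p j) * (∑ j, w j * p j)| ≤ nrm u * nrm w := by
  apply abs_le_of_sq_le_sq _ (mul_nonneg (aux_nrm_nonneg u) (aux_nrm_nonneg w))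
  rw [mul_pow, aux_nrm_sq, aux_nrm_sq]
  set m := ∑ k, w k * p k with hm
  have e1 : ∑ j, u j * w j * p j - (∑ j, u j * p j) * m
      = ∑ j, (√(p j) * u j) * (√(p j) * (w j - m)) := by
    rw [Finset.sum_mul, ← Finset.sum_sub_distrib]
    refine Finset.sum_congr rfl fun j _ => ?_
    have := Real.mul_self_sqrt (hp0 j)
    linear_combination (-(u j * (w j - m))) * this
  have e : ∑ j, p j * (w j - m) ^ 2 = ∑ j, p j * w j ^ 2 - 2 * m * ∑ j, w j * p j
      + m ^ 2 * ∑ j, p j := aux_expand p w m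
  rw [hp1, ← hm] at e
  have hw : ∑ j, p j * (w j - m) ^ 2 ≤ sqnorm w := by
    have := aux_sq_le p hp0 hp1 w
    nlinarith [sq_nonneg m]
  have hu := aux_sq_le p hp0 hp1 u
  rw [e1]
  refine (Finset.sum_mul_sq_le_sq_mul_sq _ _ _).trans ?_
  have s1 : ∑ j, (√(p j) * u j) ^ 2 = ∑ j, p j * u j ^ 2 :=
    Finset.sum_congr rfl fun j _ => by rw [mul_pow, Real.sq_sqrt (hp0 j)]
  have s2 : ∑ j, (√(p j) * (w j - m)) ^ 2 = ∑ j, p j * (w j - m) ^ 2 :=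
    Finset.sum_congr rfl fun j _ => by rw [mul_pow, Real.sq_sqrt (hp0 j)]
  rw [s1, s2]
  exact mul_le_mul hu hw (Finset.sum_nonneg fun j _ => mul_nonneg (hp0 j) (sq_nonneg _))
    (Finset.sum_nonneg fun j _ => sq_nonneg _)

theorem aux_lip {J : ℕ} (hJ : 0 < J) (a : Fin J → ℝ) (ha : ∀ j, 0 < a j) (u w : Fin J → ℝ) :
    |(∑ j, u j * (a j * Real.exp (w j))) / (∑ j, a j * Real.exp (w j))
      - (∑ j, u j * a j) / (∑ j, a j)| ≤ nrm u * nrm w := by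
  have : Nonempty (Fin J) := ⟨⟨0, hJ⟩⟩
  set Z : ℝ → ℝ := fun t => ∑ j, a j * Real.exp (t * w j) with hZ
  set N : ℝ → ℝ := fun t => ∑ j, u j * (a j * Real.exp (t * w j)) with hN
  have hZpos : ∀ t, 0 < Z t := fun t =>
    Finset.sum_pos (fun j _ => mul_pos (ha j) (Real.exp_pos _)) Finset.univ_nonempty
  have hE : ∀ (t : ℝ) j, HasDerivAt (fun t : ℝ => a j * Real.exp (t * w j))
      (w j * (a j * Real.exp (t * w j))) t := by
    intro t j
    have := (((hasDerivAt_id t).mul_const (w j)).exp).const_mul (a j)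
    refine this.congr_deriv ?_
    simp only [id, one_mul]
    ring
  have hZd : ∀ t, HasDerivAt Z (∑ j, w j * (a j * Real.exp (t * w j))) t := fun t =>
    HasDerivAt.fun_sum fun j _ => hE t j
  have hNd : ∀ t, HasDerivAt N (∑ j, u j * (w j * (a j * Real.exp (t * w j)))) t := fun t =>
    HasDerivAt.fun_sum fun j _ => (hE t j).const_mul (u j)
  have hd := fun t => (hNd t).fun_div (hZd t) (hZpos t).ne'
  have hb := Convex.norm_image_sub_le_of_norm_hasDerivWithin_le (s := Set.univ)
    (f := fun t => N t / Z t) (C := nrm u * nrm w) (x := 0) (y := 1)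
    (fun t _ => (hd t).hasDerivWithinAt) ?_ convex_univ trivial trivial
  · simpa [hZ, hN, Real.norm_eq_abs] using hb
  · intro t _
    have hz := hZpos t
    have key := aux_cov (fun j => a j * Real.exp (t * w j) / Z t)
      (fun j => (div_pos (mul_pos (ha j) (Real.exp_pos _)) hz).le)
      (by rw [← Finset.sum_div]; exact div_self hz.ne') u w
    rw [Real.norm_eq_abs]
    refine le_of_eq_of_le ?_ key
    congr 1
    simp only [mul_div_assoc', ← Finset.sum_div]
    have e1 : ∑ j, u j * w j * (a j * Real.exp (t * w j))
      = ∑ j, u j * (w j * (a j * Real.exp (t * w j))) :=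
      Finset.sum_congr rfl fun j _ => by ring
    rw [e1]
    change _ = _ - (N t / Z t * _) / Z t
    generalize ∑ j, u j * (w j * (a j * Real.exp (t * w j))) = S
    generalize ∑ j, w j * (a j * Real.exp (t * w j)) = T
    generalize Z t = z at hz
    field_simp

theorem aux_pi_nonneg {𝒳 : Type*} {J : ℕ} (ν : Fin J → ℝ) (hν : ∀ j, 0 < ν j)
    (c : 𝒳 → Fin J → ℝ) (ε : ℝ) (x : 𝒳) (v : Fin J → ℝ) (j : Fin J) :
    0 ≤ piFun J ν c ε x v j :=
  div_nonneg (mul_pos (hν j) (Real.exp_pos _)).le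
    (Finset.sum_nonneg fun k _ => (mul_pos (hν k) (Real.exp_pos _)).le)

theorem aux_pi_sum {𝒳 : Type*} {J : ℕ} (hJ : 0 < J) (ν : Fin J → ℝ) (hν : ∀ j, 0 < ν j)
    (c : 𝒳 → Fin J → ℝ) (ε : ℝ) (x : 𝒳) (v : Fin J → ℝ) :
    ∑ j, piFun J ν c ε x v j = 1 := by
  have : Nonempty (Fin J) := ⟨⟨0, hJ⟩⟩
  unfold piFun
  rw [← Finset.sum_div]
  exact div_self (Finset.sum_pos (fun j _ => mul_pos (hν j) (Real.exp_pos _))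
    Finset.univ_nonempty).ne'

theorem aux_pi_lip {𝒳 : Type*} {J : ℕ} (hJ : 0 < J) (ν : Fin J → ℝ) (hν : ∀ j, 0 < ν j)
    (c : 𝒳 → Fin J → ℝ) (ε : ℝ) (hε : 0 < ε) (x : 𝒳) (v v' u : Fin J → ℝ) :
    |∑ j, u j * piFun J ν c ε x v j - ∑ j, u j * piFun J ν c ε x v' j|
      ≤ nrm u * (nrm (v - v') / ε) := by
  have h := aux_lip hJ (fun j => ν j * Real.exp ((v' j - c x j) / ε))
    (fun j => mul_pos (hν j) (Real.exp_pos _)) u (fun j => (v j - v' j) / ε)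
  have e : ∀ j, ν j * Real.exp ((v' j - c x j) / ε) * Real.exp ((v j - v' j) / ε)
      = ν j * Real.exp ((v j - c x j) / ε) := by
    intro j
    rw [mul_assoc, ← Real.exp_add]
    congr 2
    ring
  have en : nrm (fun j => (v j - v' j) / ε) = nrm (v - v') / ε := by
    unfold nrm sqnorm
    simp only [div_pow, ← Finset.sum_div, Pi.sub_apply]
    rw [Real.sqrt_div (Finset.sum_nonneg fun j _ => sq_nonneg _), Real.sqrt_sq hε.le]
  simp only [e, en] at h
  unfold piFun
  simpa only [mul_div_assoc', ← Finset.sum_div] using h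

theorem aux_quad {𝒳 : Type*} [MeasurableSpace 𝒳] {J : ℕ} (hJ : 0 < J) (ν : Fin J → ℝ)
    (hν : ∀ j, 0 < ν j) (μ : Measure 𝒳) [IsProbabilityMeasure μ]
    (c : 𝒳 → Fin J → ℝ) (hc : ∀ j, Measurable fun x => c x j) (ε : ℝ) (v u : Fin J → ℝ) :
    Integrable (fun x => (∑ j, u j * (piFun J ν c ε x v j - ν j)) ^ 2) μ ∧
    u ⬝ᵥ (GMat J ν c ε μ v).mulVec u
      = ∫ x, (∑ j, u j * (piFun J ν c ε x v j - ν j)) ^ 2 ∂μ := by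
  have hm : ∀ j, Measurable fun x => piFun J ν c ε x v j := by
    intro j
    unfold piFun
    fun_prop
  have hle : ∀ x j, |piFun J ν c ε x v j - ν j| ≤ 1 + ν j := by
    intro x j
    have h0 := aux_pi_nonneg ν hν c ε x v j
    have h1 : piFun J ν c ε x v j ≤ 1 := by
      rw [← aux_pi_sum hJ ν hν c ε x v]
      exact Finset.single_le_sum (fun i _ => aux_pi_nonneg ν hν c ε x v i) (Finset.mem_univ j)
    have := hν j
    rw [abs_le]; constructor <;> linarith
  have hi : ∀ i j, Integrable
      (fun x => (piFun J ν c ε x v i - ν i) * (piFun J ν c ε x v j - ν j)) μ := by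
    intro i j
    refine Integrable.of_bound (C := (1 + ν i) * (1 + ν j))
      (((hm i).sub_const _).mul ((hm j).sub_const _)).aestronglyMeasurable ?_
    filter_upwards with x
    rw [Real.norm_eq_abs, abs_mul]
    exact mul_le_mul (hle x i) (hle x j) (abs_nonneg _) (by linarith [hν i])
  have e : (fun x => (∑ j, u j * (piFun J ν c ε x v j - ν j)) ^ 2)
      = fun x => ∑ i, ∑ j, u i * u j *
        ((piFun J ν c ε x v i - ν i) * (piFun J ν c ε x v j - ν j)) := by
    funext x
    rw [sq, Finset.sum_mul_sum]
    exact Finset.sum_congr rfl fun i _ => Finset.sum_congr rfl fun j _ => by ring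
  rw [e]
  refine ⟨integrable_finsetSum _ fun i _ => integrable_finsetSum _ fun j _ =>
    (hi i j).const_mul _, ?_⟩
  rw [integral_finsetSum _ fun i _ => integrable_finsetSum _ fun j _ => (hi i j).const_mul _]
  simp only [dotProduct, Matrix.mulVec, GMat, Matrix.of_apply]
  refine Finset.sum_congr rfl fun i _ => ?_
  rw [integral_finsetSum _ fun j _ => (hi i j).const_mul _, Finset.mul_sum]
  refine Finset.sum_congr rfl fun j _ => ?_
  rw [integral_const_mul]
  ring

theorem stmt_15
    {𝒳 : Type*} [MeasurableSpace 𝒳]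
    (J : ℕ) (hJ : 0 < J)
    (ν : Fin J → ℝ) (hν : ∀ j, 0 < ν j) (hνsum : ∑ j, ν j = 1)
    (μ : Measure 𝒳) [IsProbabilityMeasure μ]
    (c : 𝒳 → Fin J → ℝ) (hc_meas : ∀ j, Measurable fun x => c x j)
    (hc_nonneg : ∀ x j, 0 ≤ c x j)
    (hc_int : ∀ j, Integrable (fun x => c x j) μ)
    (ε : ℝ) (hε : 0 < ε)
    (vstar : Fin J → ℝ) (hvstar : vstar ∈ perp J)
    (hmin : ∀ v ∈ perp J, HFun J ν c ε μ vstar ≤ HFun J ν c ε μ v)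
    :
    ∀ v ∈ perp J, ∀ u : Fin J → ℝ,
      |u ⬝ᵥ (GMat J ν c ε μ v - GMat J ν c ε μ vstar).mulVec u|
        ≤ 4 / ε * nrm (v - vstar) * sqnorm u := by
  intro v _ u
  obtain ⟨i1, e1⟩ := aux_quad hJ ν hν μ c hc_meas ε v u
  obtain ⟨i2, e2⟩ := aux_quad hJ ν hν μ c hc_meas ε vstar u
  rw [Matrix.sub_mulVec, dotProduct_sub, e1, e2, ← integral_sub i1 i2, ← Real.norm_eq_abs]
  have hpt : ∀ x, ‖(∑ j, u j * (piFun J ν c ε x v j - ν j)) ^ 2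
      - (∑ j, u j * (piFun J ν c ε x vstar j - ν j)) ^ 2‖
      ≤ 4 / ε * nrm (v - vstar) * sqnorm u := by
    intro x
    have hl := aux_pi_lip hJ ν hν c ε hε x v vstar u
    have ha := abs_le.1 (aux_mean _ (aux_pi_nonneg ν hν c ε x v) (aux_pi_sum hJ ν hν c ε x v) u)
    have hb := abs_le.1 (aux_mean _ (aux_pi_nonneg ν hν c ε x vstar)
      (aux_pi_sum hJ ν hν c ε x vstar) u)
    have hn := abs_le.1 (aux_mean ν (fun j => (hν j).le) hνsum u)
    simp only [mul_sub, Finset.sum_sub_distrib]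
    set A := ∑ j, u j * piFun J ν c ε x v j
    set B := ∑ j, u j * piFun J ν c ε x vstar j
    set C := ∑ j, u j * ν j
    have hs : |A + B - 2 * C| ≤ 4 * nrm u := by
      rw [abs_le]; constructor <;> linarith [ha.1, ha.2, hb.1, hb.2, hn.1, hn.2]
    have ef : (A - C) ^ 2 - (B - C) ^ 2 = (A - B) * (A + B - 2 * C) := by ring
    rw [Real.norm_eq_abs, ef, abs_mul, ← aux_nrm_sq u]
    calc _ ≤ nrm u * (nrm (v - vstar) / ε) * (4 * nrm u) :=
          mul_le_mul hl hs (abs_nonneg _) (le_trans (abs_nonneg _) hl)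
      _ = _ := by ring
  refine (norm_integral_le_of_norm_le_const (μ := μ) (Filter.Eventually.of_forall hpt)).trans ?_
  simp

end SGNOT

end
end

section
/- There exists a positive constant d_ε such that for every u ∈ ⟨𝐯_J⟩^⊥, ‖u − u*‖² ≤ d_ε Φ(u), where Φ(u) = H̃_ε(u) exp(H̃_ε(u)). -/
open MeasureTheory Filter Finset Real Matrix ProbabilityTheory

noncomputable section

namespace SGNOT

variable {𝒳 : Type*} [MeasurableSpace 𝒳]

open scoped MatrixOrder in
theorem psd_root_unique {J : ℕ} (A B : Matrix (Fin J) (Fin J) ℝ) (hA : A.PosSemidef)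
    (hB : B.PosSemidef) (h : A * A = B * B) : A = B :=
  (CFC.mul_self_eq_mul_self_iff A B (Matrix.nonneg_iff_posSemidef.2 hA)
    (Matrix.nonneg_iff_posSemidef.2 hB)).1 h

theorem root_mul {J : ℕ} (A B G Gp : Matrix (Fin J) (Fin J) ℝ) (hA : A.PosSemidef)
    (hB : B.PosSemidef) (hG : A * A = G) (hGp : B * B = Gp) (h1 : G * Gp * G = G)
    (h2 : Gp * G * Gp = Gp) (h3 : (G * Gp)ᵀ = G * Gp) :
    A * B = G * Gp ∧ G * Gp = Gp * G := by
  have hAt : Aᵀ = A := by simpa using hA.1.eq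
  have hBt : Bᵀ = B := by simpa using hB.1.eq
  have hGt : Gᵀ = G := by rw [← hG, Matrix.transpose_mul, hAt]
  have hGpt : Gpᵀ = Gp := by rw [← hGp, Matrix.transpose_mul, hBt]
  have hcomm : G * Gp = Gp * G := by
    rw [← h3, Matrix.transpose_mul, hGt, hGpt]
  have hAG : A * G = G * A := by rw [← hG, Matrix.mul_assoc]
  have hPA : G * Gp * A = A := by
    have hz : (G * Gp * A - A) * (G * Gp * A - A)ᴴ = 0 := by
      have : (G * Gp * A - A)ᴴ = A * (G * Gp) - A := by
        simp only [Matrix.conjTranspose_eq_transpose_of_trivial, Matrix.transpose_sub, hAt]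
        rw [Matrix.transpose_mul, h3, hAt]
      rw [this]
      have e : (G * Gp * A - A) * (A * (G * Gp) - A)
          = G * Gp * (A * A) * (G * Gp) - G * Gp * (A * A) - (A * A) * (G * Gp) + A * A := by
        noncomm_ring
      rw [e, hG, h1]
      noncomm_ring
    exact sub_eq_zero.1 (Matrix.self_mul_conjTranspose_eq_zero.1 hz)
  have hAP : A * (G * Gp) = A := by
    have := congrArg Matrix.transpose hPA
    rwa [Matrix.transpose_mul, h3, hAt] at this
  have hc2 : Gp * A = A * Gp := by
    calc Gp * A = Gp * (A * (G * Gp)) := by rw [hAP]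
      _ = Gp * (A * G) * Gp := by noncomm_ring
      _ = (Gp * G) * A * Gp := by rw [hAG]; noncomm_ring
      _ = A * Gp := by rw [← hcomm, hPA]
  have hX : (A * Gp).PosSemidef := by
    have h := (hA.mul_mul_conjTranspose_same A).mul_mul_conjTranspose_same Gp
    have e : Gp * (A * A * Aᴴ) * Gpᴴ = A * Gp := by
      rw [Matrix.conjTranspose_eq_transpose_of_trivial, hAt,
        Matrix.conjTranspose_eq_transpose_of_trivial, hGpt, hG]
      rw [← hc2]
      calc Gp * (G * A) * Gp = (Gp * G) * (A * Gp) := by noncomm_ring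
        _ = G * Gp * (Gp * A) := by rw [hc2, hcomm]
        _ = Gp * G * Gp * A := by rw [hcomm]; noncomm_ring
        _ = Gp * A := by rw [h2]
    rwa [e] at h
  have hX2 : (A * Gp) * (A * Gp) = B * B := by
    rw [hGp]
    calc A * Gp * (A * Gp) = A * (Gp * A) * Gp := by noncomm_ring
      _ = (A * A) * Gp * Gp := by rw [hc2]; noncomm_ring
      _ = Gp * G * Gp := by rw [hG, hcomm]
      _ = Gp := h2
  have := psd_root_unique _ _ hX hB hX2
  refine ⟨?_, hcomm⟩
  rw [← this, ← Matrix.mul_assoc, hG]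

theorem sqnorm_nonneg' {J : ℕ} (w : Fin J → ℝ) : 0 ≤ sqnorm w :=
  Finset.sum_nonneg fun _ _ => sq_nonneg _

theorem sqnorm_mulVec_le {J : ℕ} (A : Matrix (Fin J) (Fin J) ℝ) (w : Fin J → ℝ) :
    sqnorm (A.mulVec w) ≤ frobSq A * sqnorm w := by
  unfold sqnorm frobSq
  rw [Finset.sum_mul]
  refine Finset.sum_le_sum fun i _ => ?_
  simp only [Matrix.mulVec, dotProduct]
  exact Finset.sum_mul_sq_le_sq_mul_sq _ _ _

theorem exp_quad_lower (K z : ℝ) (hz : |z| ≤ K) : 1 + z + z ^ 2 / (4 * (1 + K)) ≤ Real.exp z := by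
  have hK : 0 ≤ K := (abs_nonneg z).trans hz
  by_cases h : -2 ≤ z
  · have h1 : 1 + z / 2 ≤ Real.exp (z / 2) := by linarith [Real.add_one_le_exp (z / 2)]
    have h2 : Real.exp z = Real.exp (z / 2) ^ 2 := by
      rw [sq, ← Real.exp_add]; ring_nf
    have h3 : (1 + z / 2) ^ 2 ≤ Real.exp (z / 2) ^ 2 := by
      apply pow_le_pow_left₀ _ h1; linarith
    have h4 : z ^ 2 / (4 * (1 + K)) ≤ z ^ 2 / 4 := by
      apply div_le_div_of_nonneg_left (sq_nonneg _) (by norm_num); linarith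
    rw [h2]; nlinarith
  · push Not at h
    have h1 : z ^ 2 / (4 * (1 + K)) ≤ -z / 4 := by
      rw [div_le_iff₀ (by positivity)]
      have : -z ≤ K := (neg_le_abs z).trans hz
      nlinarith
    have := Real.exp_pos z
    linarith

section LSE
variable {J : ℕ}

theorem lse_lower (p Y : Fin J → ℝ) (hp : ∀ j, 0 ≤ p j) (hs : ∑ j, p j = 1) (M : ℝ)
    (hY : ∀ j, |Y j| ≤ M) :
    (∑ j, p j * Y j) + (1 / (4 * (1 + 2 * M) + 4 * M ^ 2)) *
        ∑ j, p j * (Y j - ∑ k, p k * Y k) ^ 2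
      ≤ Real.log (∑ j, p j * Real.exp (Y j)) := by
  have hM : 0 ≤ M := by
    have : ∃ j : Fin J, True := by
      by_contra h
      push Not at h
      have : ∑ j, p j = 0 := Finset.sum_eq_zero fun j _ => (h j).elim
      linarith
    obtain ⟨j, -⟩ := this
    exact (abs_nonneg _).trans (hY j)
  set m := ∑ k, p k * Y k with hm
  have hmM : |m| ≤ M := by
    calc |m| ≤ ∑ k, |p k * Y k| := Finset.abs_sum_le_sum_abs _ _
      _ ≤ ∑ k, p k * M := Finset.sum_le_sum fun k _ => by
          rw [abs_mul, abs_of_nonneg (hp k)]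
          exact mul_le_mul_of_nonneg_left (hY k) (hp k)
      _ = M := by rw [← Finset.sum_mul, hs, one_mul]
  set V := ∑ j, p j * (Y j - m) ^ 2 with hV
  have hz : ∀ j, |Y j - m| ≤ 2 * M := fun j => by
    have := abs_sub (Y j) m
    linarith [hY j]
  have hV0 : 0 ≤ V := Finset.sum_nonneg fun j _ => mul_nonneg (hp j) (sq_nonneg _)
  have hV1 : V ≤ (2 * M) ^ 2 := by
    calc V ≤ ∑ j, p j * (2 * M) ^ 2 := Finset.sum_le_sum fun j _ =>
          mul_le_mul_of_nonneg_left (sq_le_sq' (by linarith [(abs_le.1 (hz j)).1])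
            (abs_le.1 (hz j)).2) (hp j)
      _ = _ := by rw [← Finset.sum_mul, hs, one_mul]
  have hfac : ∑ j, p j * Real.exp (Y j) = Real.exp m * ∑ j, p j * Real.exp (Y j - m) := by
    rw [Finset.mul_sum]
    refine Finset.sum_congr rfl fun j _ => ?_
    rw [Real.exp_sub]
    field_simp
  set b := 4 * (1 + 2 * M) with hb
  have hb0 : 0 < b := by positivity
  have hlow : 1 + V / b ≤ ∑ j, p j * Real.exp (Y j - m) := by
    calc 1 + V / b = ∑ j, p j * (1 + (Y j - m) + (Y j - m) ^ 2 / b) := by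
          have : ∀ j, p j * (1 + (Y j - m) + (Y j - m) ^ 2 / b)
            = p j + (p j * Y j) - p j * m + (p j * (Y j - m) ^ 2) / b := fun j => by ring
          simp_rw [this]
          rw [Finset.sum_add_distrib, Finset.sum_sub_distrib, Finset.sum_add_distrib,
            ← Finset.sum_mul, ← Finset.sum_div, hs, ← hm, ← hV]
          ring
      _ ≤ _ := Finset.sum_le_sum fun j _ =>
          mul_le_mul_of_nonneg_left (exp_quad_lower _ _ (hz j)) (hp j)
  have hpos : 0 < 1 + V / b := by positivity
  rw [hfac, Real.log_mul (Real.exp_pos _).ne' (hpos.trans_le hlow).ne', Real.log_exp]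
  have h1 : Real.log (1 + V / b) ≤ Real.log (∑ j, p j * Real.exp (Y j - m)) :=
    Real.log_le_log hpos hlow
  have h2 : 1 - (1 + V / b)⁻¹ ≤ Real.log (1 + V / b) := Real.one_sub_inv_le_log_of_pos hpos
  have h3 : 1 / (b + 4 * M ^ 2) * V ≤ 1 - (1 + V / b)⁻¹ := by
    have e : 1 - (1 + V / b)⁻¹ = V / (b + V) := by field_simp; ring
    rw [e, one_div, inv_mul_eq_div]
    apply div_le_div_of_nonneg_left hV0 (by positivity)
    nlinarith
  linarith

theorem lse_upper (p Y : Fin J → ℝ) (hp : ∀ j, 0 ≤ p j) (hs : ∑ j, p j = 1) (s : ℝ)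
    (hY : ∀ j, |Y j| ≤ s) (hs1 : s ≤ 1) (hpos : 0 < ∑ j, p j * Real.exp (Y j)) :
    Real.log (∑ j, p j * Real.exp (Y j)) ≤ (∑ j, p j * Y j) + s ^ 2 := by
  have h : ∑ j, p j * Real.exp (Y j) ≤ 1 + (∑ j, p j * Y j) + s ^ 2 := by
    calc _ ≤ ∑ j, p j * (1 + Y j + s ^ 2) := Finset.sum_le_sum fun j _ => by
          refine mul_le_mul_of_nonneg_left ?_ (hp j)
          have h1 := (abs_le.1 (Real.abs_exp_sub_one_sub_id_le ((hY j).trans hs1))).2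
          have h2 : Y j ^ 2 ≤ s ^ 2 := sq_le_sq' (by linarith [(abs_le.1 (hY j)).1])
            (abs_le.1 (hY j)).2
          linarith
      _ = _ := by
          simp_rw [mul_add, mul_one]
          rw [Finset.sum_add_distrib, Finset.sum_add_distrib, ← Finset.sum_mul, hs, one_mul]
  have := Real.log_le_sub_one_of_pos hpos
  linarith

theorem lse_abs (p Y : Fin J → ℝ) (hp : ∀ j, 0 ≤ p j) (hs : ∑ j, p j = 1) (M : ℝ)
    (hY : ∀ j, |Y j| ≤ M) : |Real.log (∑ j, p j * Real.exp (Y j))| ≤ M := by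
  have hl : Real.exp (-M) ≤ ∑ j, p j * Real.exp (Y j) := by
    calc Real.exp (-M) = ∑ j, p j * Real.exp (-M) := by rw [← Finset.sum_mul, hs, one_mul]
      _ ≤ _ := Finset.sum_le_sum fun j _ => mul_le_mul_of_nonneg_left
          (Real.exp_le_exp.2 (abs_le.1 (hY j)).1) (hp j)
  have hu : ∑ j, p j * Real.exp (Y j) ≤ Real.exp M := by
    calc _ ≤ ∑ j, p j * Real.exp M := Finset.sum_le_sum fun j _ => mul_le_mul_of_nonneg_left
          (Real.exp_le_exp.2 (abs_le.1 (hY j)).2) (hp j)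
      _ = _ := by rw [← Finset.sum_mul, hs, one_mul]
  have hpos := (Real.exp_pos (-M)).trans_le hl
  exact abs_le.2 ⟨(Real.le_log_iff_exp_le hpos).2 hl, (Real.log_le_iff_le_exp hpos).2 hu⟩

theorem lse_scale (p Y : Fin J → ℝ) (hp : ∀ j, 0 < p j) (hs : ∑ j, p j = 1) (t : ℝ)
    (ht0 : 0 ≤ t) (ht1 : t ≤ 1) (hne : (Finset.univ : Finset (Fin J)).Nonempty) :
    Real.log (∑ j, p j * Real.exp (t * Y j)) ≤ t * Real.log (∑ j, p j * Real.exp (Y j)) := by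
  set S := ∑ j, p j * Real.exp (Y j) with hS
  have hSpos : 0 < S := Finset.sum_pos (fun j _ => mul_pos (hp j) (Real.exp_pos _)) hne
  have hTpos : 0 < ∑ j, p j * Real.exp (t * Y j) :=
    Finset.sum_pos (fun j _ => mul_pos (hp j) (Real.exp_pos _)) hne
  rw [Real.log_le_iff_le_exp hTpos]
  have key : ∀ j, Real.exp (t * Y j) ≤ Real.exp (t * Real.log S) *
      ((1 - t) + t * (Real.exp (Y j) / S)) := fun j => by
    have h := convexOn_exp.2 (Set.mem_univ (0 : ℝ)) (Set.mem_univ (Y j - Real.log S))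
      (sub_nonneg.2 ht1) ht0 (by ring)
    simp only [smul_eq_mul, mul_zero, zero_add, Real.exp_zero, mul_one, Real.exp_sub,
      Real.exp_log hSpos] at h
    calc Real.exp (t * Y j) = Real.exp (t * Real.log S) * Real.exp (t * (Y j - Real.log S)) := by
          rw [← Real.exp_add]; ring_nf
      _ ≤ _ := mul_le_mul_of_nonneg_left h (Real.exp_pos _).le
  calc _ ≤ ∑ j, p j * (Real.exp (t * Real.log S) * ((1 - t) + t * (Real.exp (Y j) / S))) :=
        Finset.sum_le_sum fun j _ => mul_le_mul_of_nonneg_left (key j) (hp j).le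
    _ = Real.exp (t * Real.log S) * ((1 - t) * ∑ j, p j + t * (S / S)) := by
        rw [hS, Finset.sum_div, Finset.mul_sum, Finset.mul_sum, ← Finset.sum_add_distrib,
          Finset.mul_sum]
        exact Finset.sum_congr rfl fun j _ => by ring
    _ = _ := by rw [hs, div_self hSpos.ne']; ring

theorem var_lower (p w : Fin J → ℝ) (hp : ∀ j, 0 < p j) (hs : ∑ j, p j = 1)
    (hw : ∑ j, w j = 0) (m : ℝ) :
    (∏ j, p j) * sqnorm w ≤ ∑ j, p j * (w j - m) ^ 2 := by
  have hp1 : ∀ j, p j ≤ 1 := fun j => by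
    rw [← hs]; exact Finset.single_le_sum (fun k _ => (hp k).le) (Finset.mem_univ j)
  have hr0 : 0 ≤ ∏ j, p j := Finset.prod_nonneg fun j _ => (hp j).le
  have hr : ∀ j, ∏ j, p j ≤ p j := fun j => by
    rw [← Finset.mul_prod_erase _ _ (Finset.mem_univ j)]
    exact mul_le_of_le_one_right (hp j).le
      (Finset.prod_le_one (fun k _ => (hp k).le) fun k _ => hp1 k)
  have hsq : sqnorm w ≤ ∑ j, (w j - m) ^ 2 := by
    have : ∑ j, (w j - m) ^ 2 = sqnorm w - 2 * m * (∑ j, w j) + ∑ _j : Fin J, m ^ 2 := by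
      unfold sqnorm
      rw [Finset.mul_sum, ← Finset.sum_sub_distrib, ← Finset.sum_add_distrib]
      exact Finset.sum_congr rfl fun j _ => by ring
    rw [this, hw]
    have : 0 ≤ ∑ _j : Fin J, m ^ 2 := Finset.sum_nonneg fun _ _ => sq_nonneg _
    linarith
  calc _ ≤ (∏ j, p j) * ∑ j, (w j - m) ^ 2 := mul_le_mul_of_nonneg_left hsq hr0
    _ ≤ _ := by
      rw [Finset.mul_sum]
      exact Finset.sum_le_sum fun j _ => mul_le_mul_of_nonneg_right (hr j) (sq_nonneg _)

end LSE

/-- The excess risk written through the conditional probabilities `p`. -/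
def excess (J : ℕ) (p : 𝒳 → Fin J → ℝ) (ν : Fin J → ℝ) (ε : ℝ) (μ : Measure 𝒳)
    (w : Fin J → ℝ) : ℝ :=
  ∫ x, (ε * Real.log (∑ j, p x j * Real.exp (w j / ε)) - ∑ j, ν j * w j) ∂μ

section Excess
variable {J : ℕ} {p : 𝒳 → Fin J → ℝ} {ν : Fin J → ℝ} {ε : ℝ} {μ : Measure 𝒳}

theorem abs_le_of_sqnorm (w : Fin J → ℝ) (j : Fin J) : |w j| ≤ Real.sqrt (sqnorm w) := by
  apply Real.abs_le_sqrt
  exact Finset.single_le_sum (f := fun j => w j ^ 2) (fun k _ => sq_nonneg _) (Finset.mem_univ j)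

theorem lse_integrable [IsProbabilityMeasure μ] (hpm : ∀ j, Measurable fun x => p x j)
    (hp : ∀ x j, 0 < p x j) (hs : ∀ x, ∑ j, p x j = 1) (w : Fin J → ℝ) :
    Integrable (fun x => Real.log (∑ j, p x j * Real.exp (w j / ε))) μ := by
  refine Integrable.of_bound (C := Real.sqrt (sqnorm fun j => w j / ε)) ?_ ?_
  · exact (Real.measurable_log.comp (Finset.measurable_sum _ fun j _ =>
      (hpm j).mul_const _)).aestronglyMeasurable
  · exact Filter.Eventually.of_forall fun x => by
      rw [Real.norm_eq_abs]
      exact lse_abs (p x) (fun j => w j / ε) (fun j => (hp x j).le) (hs x) _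
        (abs_le_of_sqnorm fun j => w j / ε)

theorem mean_integrable [IsProbabilityMeasure μ] (hpm : ∀ j, Measurable fun x => p x j)
    (hp : ∀ x j, 0 < p x j) (hs : ∀ x, ∑ j, p x j = 1) (w : Fin J → ℝ) :
    Integrable (fun x => ∑ j, p x j * w j) μ := by
  refine integrable_finsetSum _ fun j _ => Integrable.mul_const ?_ _
  refine Integrable.of_bound (C := 1) (hpm j).aestronglyMeasurable ?_
  exact Filter.Eventually.of_forall fun x => by
    rw [Real.norm_eq_abs, abs_of_pos (hp x j), ← hs x]
    exact Finset.single_le_sum (fun k _ => (hp x k).le) (Finset.mem_univ j)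

theorem excess_scale [IsProbabilityMeasure μ] (hε : 0 < ε)
    (hpm : ∀ j, Measurable fun x => p x j)
    (hp : ∀ x j, 0 < p x j) (hs : ∀ x, ∑ j, p x j = 1)
    (hne : (Finset.univ : Finset (Fin J)).Nonempty) (w : Fin J → ℝ) (t : ℝ)
    (ht0 : 0 ≤ t) (ht1 : t ≤ 1) :
    excess J p ν ε μ (t • w) ≤ t * excess J p ν ε μ w := by
  unfold excess
  rw [← integral_const_mul]
  refine integral_mono (((lse_integrable hpm hp hs _).const_mul _).sub (integrable_const _))
    ((((lse_integrable hpm hp hs _).const_mul _).sub (integrable_const _)).const_mul _) ?_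
  intro x
  have h := lse_scale (p x) (fun j => w j / ε) (hp x) (hs x) t ht0 ht1 hne
  have e1 : ∀ j, (t • w) j / ε = t * (w j / ε) := fun j => by
    simp only [Pi.smul_apply, smul_eq_mul]; ring
  have e2 : ∑ j, ν j * (t • w) j = t * ∑ j, ν j * w j := by
    rw [Finset.mul_sum]
    exact Finset.sum_congr rfl fun j _ => by simp only [Pi.smul_apply, smul_eq_mul]; ring
  simp only [e1, e2]
  have := mul_le_mul_of_nonneg_left h hε.le
  linarith

/-- First-order condition. -/
theorem excess_foc [IsProbabilityMeasure μ] (hε : 0 < ε)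
    (hpm : ∀ j, Measurable fun x => p x j)
    (hp : ∀ x j, 0 < p x j) (hs : ∀ x, ∑ j, p x j = 1)
    (hne : (Finset.univ : Finset (Fin J)).Nonempty)
    (hmin : ∀ w : Fin J → ℝ, ∑ j, w j = 0 → 0 ≤ excess J p ν ε μ w)
    (w : Fin J → ℝ) (hw : ∑ j, w j = 0) :
    ∑ j, ν j * w j ≤ ∫ x, ∑ j, p x j * w j ∂μ := by
  set a := ∫ x, ∑ j, p x j * w j ∂μ with ha
  set b := ∑ j, ν j * w j with hb
  set M := Real.sqrt (sqnorm w) / ε with hM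
  have hM0 : 0 ≤ M := by positivity
  -- for small `s`, `0 ≤ s (a - b) + ε s² M²`
  have key : ∀ s : ℝ, 0 < s → s * M ≤ 1 → 0 ≤ s * (a - b) + ε * (s * M) ^ 2 := by
    intro s hs0 hs1
    have h0 := hmin (s • w) (by
      simp only [Pi.smul_apply, smul_eq_mul, ← Finset.mul_sum, hw, mul_zero])
    refine h0.trans ?_
    have hint := mean_integrable (μ := μ) hpm hp hs w
    have e : s * (a - b) + ε * (s * M) ^ 2
        = ∫ x, (s * (∑ j, p x j * w j) - s * b + ε * (s * M) ^ 2) ∂μ := by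
      have i1 : Integrable (fun x => s * (∑ j, p x j * w j)) μ := hint.const_mul _
      have i2 : Integrable (fun x => s * (∑ j, p x j * w j) - s * b) μ :=
        i1.sub (integrable_const _)
      rw [integral_add i2 (integrable_const _), integral_sub i1 (integrable_const _),
        integral_const_mul]
      simp only [integral_const, probReal_univ, one_smul]
      ring
    rw [e]
    unfold excess
    refine integral_mono (((lse_integrable hpm hp hs _).const_mul _).sub (integrable_const _))
      (((hint.const_mul _).sub (integrable_const _)).add (integrable_const _)) ?_
    intro x
    have e2 : ∑ j, ν j * (s • w) j = s * b := by
      rw [hb, Finset.mul_sum]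
      exact Finset.sum_congr rfl fun j _ => by simp only [Pi.smul_apply, smul_eq_mul]; ring
    have hup := lse_upper (p x) (fun j => (s • w) j / ε) (fun j => (hp x j).le) (hs x) (s * M)
      (fun j => by
        simp only [Pi.smul_apply, smul_eq_mul]
        rw [abs_div, abs_mul, abs_of_pos hs0, abs_of_pos hε, hM, ← mul_div_assoc]
        gcongr
        exact abs_le_of_sqnorm w j) hs1
      (Finset.sum_pos (fun j _ => mul_pos (hp x j) (Real.exp_pos _)) hne)
    have e3 : ε * ∑ j, p x j * ((s • w) j / ε) = s * ∑ j, p x j * w j := by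
      rw [Finset.mul_sum, Finset.mul_sum]
      refine Finset.sum_congr rfl fun j _ => ?_
      simp only [Pi.smul_apply, smul_eq_mul]
      field_simp
    have := mul_le_mul_of_nonneg_left hup hε.le
    rw [mul_add, e3] at this
    simp only [e2]
    linarith
  by_contra hlt
  push Not at hlt
  set δ := b - a with hδ
  have hδ0 : 0 < δ := by linarith
  set s := min (1 / (M + 1)) (δ / (2 * ε * (M ^ 2 + 1))) with hsdef
  have hs0 : 0 < s := by positivity
  have h1 : s * M ≤ 1 := by
    have : s ≤ 1 / (M + 1) := min_le_left _ _
    rw [le_div_iff₀ (by positivity)] at this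
    nlinarith
  have h2 : s * (2 * ε * (M ^ 2 + 1)) ≤ δ := by
    have : s ≤ δ / (2 * ε * (M ^ 2 + 1)) := min_le_right _ _
    rwa [le_div_iff₀ (by positivity)] at this
  have h3 := key s hs0 h1
  have h4 : 0 ≤ s * ((a - b) + ε * s * M ^ 2) := by
    calc 0 ≤ _ := h3
      _ = _ := by ring
  have h5 := nonneg_of_mul_nonneg_right h4 hs0
  have : 0 < s * ε := mul_pos hs0 hε
  nlinarith [sq_nonneg M]

theorem excess_local [IsProbabilityMeasure μ] (hε : 0 < ε)
    (hpm : ∀ j, Measurable fun x => p x j)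
    (hp : ∀ x j, 0 < p x j) (hs : ∀ x, ∑ j, p x j = 1)
    (hne : (Finset.univ : Finset (Fin J)).Nonempty)
    (hmin : ∀ w : Fin J → ℝ, ∑ j, w j = 0 → 0 ≤ excess J p ν ε μ w) :
    ∃ a : ℝ, 0 < a ∧ ∀ w : Fin J → ℝ, ∑ j, w j = 0 → sqnorm w ≤ 1 →
      a * sqnorm w ≤ excess J p ν ε μ w := by
  set M := 1 / ε with hM
  set κ := 1 / (4 * (1 + 2 * M) + 4 * M ^ 2) with hκ
  have hM0 : 0 < M := by positivity
  have hκ0 : 0 < κ := by positivity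
  have hp1 : ∀ x j, p x j ≤ 1 := fun x j => by
    rw [← hs x]; exact Finset.single_le_sum (fun k _ => (hp x k).le) (Finset.mem_univ j)
  have hρpos : ∀ x, 0 < ∏ j, p x j := fun x => Finset.prod_pos fun j _ => hp x j
  have hρint : Integrable (fun x => ∏ j, p x j) μ := by
    refine Integrable.of_bound (C := 1)
      (Finset.measurable_prod _ fun j _ => hpm j).aestronglyMeasurable ?_
    exact Filter.Eventually.of_forall fun x => by
      rw [Real.norm_eq_abs, abs_of_pos (hρpos x)]
      exact Finset.prod_le_one (fun k _ => (hp x k).le) fun k _ => hp1 x k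
  have hq : 0 < ∫ x, ∏ j, p x j ∂μ := by
    rw [integral_pos_iff_support_of_nonneg (fun x => (hρpos x).le) hρint]
    have : Function.support (fun x => ∏ j, p x j) = Set.univ := by
      ext x; simp only [Function.mem_support, Set.mem_univ, iff_true]; exact (hρpos x).ne'
    rw [this]; simp
  refine ⟨κ / ε * ∫ x, ∏ j, p x j ∂μ, by positivity, fun w hw hw1 => ?_⟩
  have hfoc := excess_foc (ν := ν) hε hpm hp hs hne hmin w hw
  have hint := mean_integrable (μ := μ) hpm hp hs w
  have hY : ∀ j, |w j / ε| ≤ M := fun j => by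
    rw [abs_div, abs_of_pos hε, hM]
    gcongr
    exact (abs_le_of_sqnorm w j).trans (Real.sqrt_le_one.2 hw1)
  have hpt : ∀ x, (∑ j, p x j * w j) - (∑ j, ν j * w j) + κ / ε * sqnorm w * ∏ j, p x j
      ≤ ε * Real.log (∑ j, p x j * Real.exp (w j / ε)) - ∑ j, ν j * w j := by
    intro x
    have h := lse_lower (p x) (fun j => w j / ε) (fun j => (hp x j).le) (hs x) M hY
    have e : ε * ∑ j, p x j * (w j / ε) = ∑ j, p x j * w j := by
      rw [Finset.mul_sum]
      exact Finset.sum_congr rfl fun j _ => by field_simp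
    set m := ∑ j, p x j * (w j / ε) with hm
    have e2 : ∑ j, p x j * (w j / ε - m) ^ 2 = (∑ j, p x j * (w j - ε * m) ^ 2) / ε ^ 2 := by
      rw [Finset.sum_div]
      exact Finset.sum_congr rfl fun j _ => by field_simp
    have hv := var_lower (p x) w (hp x) (hs x) hw (ε * m)
    rw [e2, ← hκ] at h
    have h2 : κ / ε * ((∏ j, p x j) * sqnorm w) ≤ κ / ε * ∑ j, p x j * (w j - ε * m) ^ 2 :=
      mul_le_mul_of_nonneg_left hv (by positivity)
    have h3 := mul_le_mul_of_nonneg_left h hε.le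
    have h4 : ε * (m + κ * ((∑ j, p x j * (w j - ε * m) ^ 2) / ε ^ 2))
        = ε * m + κ / ε * ∑ j, p x j * (w j - ε * m) ^ 2 := by field_simp
    rw [h4] at h3
    linarith
  have h := integral_mono (μ := μ)
    ((hint.sub (integrable_const (∑ j, ν j * w j))).add (hρint.const_mul (κ / ε * sqnorm w)))
    (((lse_integrable (ε := ε) hpm hp hs w).const_mul ε).sub (integrable_const _)) hpt
  unfold excess
  refine le_trans ?_ h
  rw [integral_add' (hint.sub (integrable_const (∑ j, ν j * w j)))
    (hρint.const_mul (κ / ε * sqnorm w)), integral_sub' hint (integrable_const _),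
    integral_const_mul]
  simp only [integral_const, probReal_univ, one_smul]
  linarith

theorem excess_main [IsProbabilityMeasure μ] (hε : 0 < ε)
    (hpm : ∀ j, Measurable fun x => p x j)
    (hp : ∀ x j, 0 < p x j) (hs : ∀ x, ∑ j, p x j = 1)
    (hne : (Finset.univ : Finset (Fin J)).Nonempty)
    (hmin : ∀ w : Fin J → ℝ, ∑ j, w j = 0 → 0 ≤ excess J p ν ε μ w) :
    ∃ d : ℝ, 0 < d ∧ ∀ w : Fin J → ℝ, ∑ j, w j = 0 →
      sqnorm w ≤ d * (excess J p ν ε μ w * Real.exp (excess J p ν ε μ w)) := by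
  obtain ⟨a, ha, hloc⟩ := excess_local (ν := ν) hε hpm hp hs hne hmin
  refine ⟨1 / a + 1 / a ^ 2, by positivity, fun w hw => ?_⟩
  have hD := hmin w hw
  set D := excess J p ν ε μ w with hDdef
  have hexp := Real.add_one_le_exp D
  by_cases h : sqnorm w ≤ 1
  · have h1 := hloc w hw h
    have h2 : sqnorm w ≤ 1 / a * D := by
      rw [one_div, inv_mul_eq_div, le_div_iff₀ ha]; linarith
    have h3 : D ≤ D * Real.exp D := le_mul_of_one_le_right hD (by linarith)
    have h4 : 1 / a * D ≤ 1 / a * (D * Real.exp D) :=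
      mul_le_mul_of_nonneg_left h3 (by positivity)
    have h5 : 0 ≤ 1 / a ^ 2 * (D * Real.exp D) := by positivity
    linarith
  · push Not at h
    set r := Real.sqrt (sqnorm w) with hr
    have hr2 : r ^ 2 = sqnorm w := Real.sq_sqrt (sqnorm_nonneg' w)
    have hr1 : 1 ≤ r := Real.one_le_sqrt.2 h.le
    have hr0 : 0 < r := by linarith
    have hsc := excess_scale (μ := μ) (ν := ν) hε hpm hp hs hne w r⁻¹ (by positivity)
      (inv_le_one_of_one_le₀ hr1)
    have hsq : sqnorm (r⁻¹ • w) = 1 := by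
      have : sqnorm (r⁻¹ • w) = r⁻¹ ^ 2 * sqnorm w := by
        unfold sqnorm
        rw [Finset.mul_sum]
        exact Finset.sum_congr rfl fun j _ => by
          simp only [Pi.smul_apply, smul_eq_mul]; ring
      rw [this, ← hr2]; field_simp
    have h1 := hloc (r⁻¹ • w) (by
      simp only [Pi.smul_apply, smul_eq_mul, ← Finset.mul_sum, hw, mul_zero]) hsq.le
    rw [hsq, mul_one] at h1
    have h2 : a * r ≤ D := by
      have := h1.trans hsc
      rw [← hDdef, inv_mul_eq_div, le_div_iff₀ hr0] at this
      exact this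
    have h3 : (a * r) ^ 2 ≤ D * Real.exp D := by
      have : (a * r) ^ 2 ≤ D ^ 2 := pow_le_pow_left₀ (by positivity) h2 2
      nlinarith
    have h4 : 1 / a ^ 2 * (a * r) ^ 2 ≤ 1 / a ^ 2 * (D * Real.exp D) :=
      mul_le_mul_of_nonneg_left h3 (by positivity)
    have h5 : 1 / a ^ 2 * (a * r) ^ 2 = sqnorm w := by rw [← hr2]; field_simp
    have h6 : 0 ≤ 1 / a * (D * Real.exp D) := by positivity
    linarith

end Excess

section Link
variable {J : ℕ} {ν : Fin J → ℝ} {c : 𝒳 → Fin J → ℝ} {ε : ℝ} {μ : Measure 𝒳}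

theorem piFun_pos (hne : (Finset.univ : Finset (Fin J)).Nonempty) (hν : ∀ j, 0 < ν j)
    (x : 𝒳) (v : Fin J → ℝ) (j : Fin J) : 0 < piFun J ν c ε x v j :=
  div_pos (mul_pos (hν j) (Real.exp_pos _))
    (Finset.sum_pos (fun k _ => mul_pos (hν k) (Real.exp_pos _)) hne)

theorem piFun_sum (hne : (Finset.univ : Finset (Fin J)).Nonempty) (hν : ∀ j, 0 < ν j)
    (x : 𝒳) (v : Fin J → ℝ) : ∑ j, piFun J ν c ε x v j = 1 := by
  unfold piFun
  rw [← Finset.sum_div]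
  exact div_self (Finset.sum_pos (fun k _ => mul_pos (hν k) (Real.exp_pos _)) hne).ne'

theorem piFun_meas (hc_meas : ∀ j, Measurable fun x => c x j) (v : Fin J → ℝ) (j : Fin J) :
    Measurable fun x => piFun J ν c ε x v j := by
  unfold piFun
  have h : ∀ k, Measurable fun x => ν k * Real.exp ((v k - c x k) / ε) := fun k =>
    (Real.measurable_exp.comp (((hc_meas k).const_sub _).div_const _)).const_mul _
  exact (h j).div (Finset.measurable_sum _ fun k _ => h k)

theorem hFun_diff (hne : (Finset.univ : Finset (Fin J)).Nonempty) (hν : ∀ j, 0 < ν j)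
    (x : 𝒳) (v w : Fin J → ℝ) :
    hFun J ν c ε x (v + w) = hFun J ν c ε x v +
      (ε * Real.log (∑ j, piFun J ν c ε x v j * Real.exp (w j / ε)) - ∑ j, ν j * w j) := by
  have hpos : 0 < ∑ k, ν k * Real.exp ((v k - c x k) / ε) :=
    Finset.sum_pos (fun k _ => mul_pos (hν k) (Real.exp_pos _)) hne
  have hpos2 : 0 < ∑ j, piFun J ν c ε x v j * Real.exp (w j / ε) :=
    Finset.sum_pos (fun k _ => mul_pos (piFun_pos hne hν x v k) (Real.exp_pos _)) hne
  have e : ∑ j, ν j * Real.exp (((v + w) j - c x j) / ε)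
      = (∑ k, ν k * Real.exp ((v k - c x k) / ε)) *
        ∑ j, piFun J ν c ε x v j * Real.exp (w j / ε) := by
    rw [Finset.mul_sum]
    refine Finset.sum_congr rfl fun j _ => ?_
    have : ((v + w) j - c x j) / ε = (v j - c x j) / ε + w j / ε := by
      simp only [Pi.add_apply]; ring
    rw [this, Real.exp_add]
    unfold piFun
    field_simp
  unfold hFun
  rw [e, Real.log_mul hpos.ne' hpos2.ne']
  simp only [Pi.add_apply, mul_add, Finset.sum_add_distrib]
  ring

theorem hFun_integrable [IsProbabilityMeasure μ]
    (hne : (Finset.univ : Finset (Fin J)).Nonempty) (hν : ∀ j, 0 < ν j)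
    (hνsum : ∑ j, ν j = 1) (hc_meas : ∀ j, Measurable fun x => c x j)
    (hc_nonneg : ∀ x j, 0 ≤ c x j)
    (hc_int : ∀ j, Integrable (fun x => c x j) μ) (hε : 0 < ε) (v : Fin J → ℝ) :
    Integrable (fun x => hFun J ν c ε x v) μ := by
  have hlog : Integrable (fun x => Real.log (∑ j, ν j * Real.exp ((v j - c x j) / ε))) μ := by
    have hdom : Integrable (fun x => ∑ j, (|v j| / ε + c x j / ε)) μ :=
      integrable_finsetSum _ fun j _ => (integrable_const _).add ((hc_int j).div_const _)
    refine hdom.mono' ?_ ?_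
    · exact (Real.measurable_log.comp (Finset.measurable_sum _ fun k _ =>
        (Real.measurable_exp.comp
          (((hc_meas k).const_sub _).div_const _)).const_mul _)).aestronglyMeasurable
    · refine Filter.Eventually.of_forall fun x => ?_
      rw [Real.norm_eq_abs]
      refine lse_abs ν (fun j => (v j - c x j) / ε) (fun j => (hν j).le) hνsum _ fun j => ?_
      have h1 : |(v j - c x j) / ε| ≤ |v j| / ε + c x j / ε := by
        rw [abs_div, abs_of_pos hε, ← add_div]
        gcongr
        have := abs_sub (v j) (c x j)
        rwa [abs_of_nonneg (hc_nonneg x j)] at this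
      refine h1.trans ?_
      exact Finset.single_le_sum (f := fun j => |v j| / ε + c x j / ε)
        (fun k _ => add_nonneg (by positivity) (div_nonneg (hc_nonneg x k) hε.le))
        (Finset.mem_univ j)
  unfold hFun
  exact ((integrable_const _).add (hlog.const_mul _)).sub (integrable_const _)

theorem HFun_diff [IsProbabilityMeasure μ]
    (hne : (Finset.univ : Finset (Fin J)).Nonempty) (hν : ∀ j, 0 < ν j)
    (hνsum : ∑ j, ν j = 1) (hc_meas : ∀ j, Measurable fun x => c x j)
    (hc_nonneg : ∀ x j, 0 ≤ c x j)
    (hc_int : ∀ j, Integrable (fun x => c x j) μ) (hε : 0 < ε) (v w : Fin J → ℝ) :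
    HFun J ν c ε μ (v + w) - HFun J ν c ε μ v
      = excess J (fun x => piFun J ν c ε x v) ν ε μ w := by
  unfold HFun excess
  rw [← integral_sub (hFun_integrable hne hν hνsum hc_meas hc_nonneg hc_int hε _)
    (hFun_integrable hne hν hνsum hc_meas hc_nonneg hc_int hε _)]
  congr 1
  ext x
  rw [hFun_diff hne hν]
  ring

theorem GMat_one (hne : (Finset.univ : Finset (Fin J)).Nonempty) [IsProbabilityMeasure μ]
    (hν : ∀ j, 0 < ν j)
    (hνsum : ∑ j, ν j = 1) (hc_meas : ∀ j, Measurable fun x => c x j) (v : Fin J → ℝ) :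
    (GMat J ν c ε μ v).mulVec (fun _ => 1) = 0 := by
  have hp := fun x j => piFun_pos (c := c) (ε := ε) hne hν x v j
  have hs := fun x => piFun_sum (c := c) (ε := ε) hne hν x v
  have hpm := fun j => piFun_meas (ν := ν) (ε := ε) hc_meas v j
  have hb : ∀ x j, ‖piFun J ν c ε x v j - ν j‖ ≤ 1 := fun x j => by
    have h1 : piFun J ν c ε x v j ≤ 1 := by
      rw [← hs x]; exact Finset.single_le_sum (fun k _ => (hp x k).le) (Finset.mem_univ j)
    have h2 : ν j ≤ 1 := by
      rw [← hνsum]; exact Finset.single_le_sum (fun k _ => (hν k).le) (Finset.mem_univ j)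
    rw [Real.norm_eq_abs, abs_le]
    constructor <;> linarith [hp x j, hν j]
  ext i
  simp only [Matrix.mulVec, dotProduct, GMat, Matrix.of_apply, mul_one, Pi.zero_apply]
  rw [← integral_finsetSum]
  · simp_rw [← Finset.mul_sum, Finset.sum_sub_distrib, hs, hνsum]
    simp
  · intro j _
    refine Integrable.of_bound (C := 1)
      (((hpm i).sub_const _).mul ((hpm j).sub_const _)).aestronglyMeasurable ?_
    refine Filter.Eventually.of_forall fun x => ?_
    rw [norm_mul]
    exact mul_le_one₀ (hb x i) (norm_nonneg _) (hb x j)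

end Link

theorem stmt_17
    {𝒳 : Type*} [MeasurableSpace 𝒳]
    (J : ℕ) (hJ : 0 < J)
    (ν : Fin J → ℝ) (hν : ∀ j, 0 < ν j) (hνsum : ∑ j, ν j = 1)
    (μ : Measure 𝒳) [IsProbabilityMeasure μ]
    (c : 𝒳 → Fin J → ℝ) (hc_meas : ∀ j, Measurable fun x => c x j)
    (hc_nonneg : ∀ x j, 0 ≤ c x j)
    (hc_int : ∀ j, Integrable (fun x => c x j) μ)
    (ε : ℝ) (hε : 0 < ε)
    (vstar : Fin J → ℝ) (hvstar : vstar ∈ perp J)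
    (hmin : ∀ v ∈ perp J, HFun J ν c ε μ vstar ≤ HFun J ν c ε μ v)
    (huniq : ∀ v ∈ perp J, (∀ w ∈ perp J, HFun J ν c ε μ v ≤ HFun J ν c ε μ w) → v = vstar)
    (hinv : ∀ u ∈ perp J, u ≠ 0 → 0 < u ⬝ᵥ (GMat J ν c ε μ vstar).mulVec u)
    (Gpinv : Matrix (Fin J) (Fin J) ℝ)
    (hGpinv1 : GMat J ν c ε μ vstar * Gpinv * GMat J ν c ε μ vstar = GMat J ν c ε μ vstar)
    (hGpinv2 : Gpinv * GMat J ν c ε μ vstar * Gpinv = Gpinv)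
    (hGpinv3 : (GMat J ν c ε μ vstar * Gpinv)ᵀ = GMat J ν c ε μ vstar * Gpinv)
    (hGpinv4 : (Gpinv * GMat J ν c ε μ vstar)ᵀ = Gpinv * GMat J ν c ε μ vstar)
    (Gsqrt : Matrix (Fin J) (Fin J) ℝ)
    (hGsqrtPSD : Gsqrt.PosSemidef) (hGsqrtSq : Gsqrt * Gsqrt = GMat J ν c ε μ vstar)
    (Ginvsqrt : Matrix (Fin J) (Fin J) ℝ)
    (hGinvsqrtPSD : Ginvsqrt.PosSemidef) (hGinvsqrtSq : Ginvsqrt * Ginvsqrt = Gpinv)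
    :
    ∃ d : ℝ, 0 < d ∧ ∀ u ∈ perp J,
      sqnorm (u - Gsqrt.mulVec vstar) ≤ d * PhiFun J ν c ε μ Ginvsqrt vstar u := by
  have hne : (Finset.univ : Finset (Fin J)).Nonempty := ⟨⟨0, hJ⟩, Finset.mem_univ _⟩
  have hdiff := fun w => HFun_diff hne hν hνsum hc_meas hc_nonneg hc_int hε vstar w
  obtain ⟨d, hd, hmain⟩ := excess_main (μ := μ) (ν := ν) hε
    (p := fun x => piFun J ν c ε x vstar)
    (fun j => piFun_meas hc_meas vstar j) (fun x j => piFun_pos hne hν x vstar j)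
    (fun x => piFun_sum hne hν x vstar) hne (fun w hw => by
      rw [← hdiff w]
      refine sub_nonneg.2 (hmin _ ?_)
      have h1 : ∑ j, vstar j = 0 := hvstar
      show ∑ j, (vstar + w) j = 0
      simp only [Pi.add_apply, Finset.sum_add_distrib, h1, hw, add_zero])
  have hG1 := GMat_one (μ := μ) (ε := ε) hne hν hνsum hc_meas vstar
  set G := GMat J ν c ε μ vstar with hG
  obtain ⟨hAB, hcomm⟩ := root_mul Gsqrt Ginvsqrt G Gpinv hGsqrtPSD hGinvsqrtPSD hGsqrtSq
    hGinvsqrtSq hGpinv1 hGpinv2 hGpinv3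
  have hBt : Ginvsqrtᵀ = Ginvsqrt := by simpa using hGinvsqrtPSD.1.eq
  have hAt : Gsqrtᵀ = Gsqrt := by simpa using hGsqrtPSD.1.eq
  have hGt : Gᵀ = G := by rw [← hGsqrtSq, Matrix.transpose_mul, hAt]
  -- the constant vector is in the kernel of `Ginvsqrt`
  have hp1 : Gpinv.mulVec (fun _ => 1) = 0 := by
    rw [← hGpinv2, Matrix.mul_assoc, hcomm, ← Matrix.mulVec_mulVec, ← Matrix.mulVec_mulVec, hG1]
    simp
  have hB1 : Ginvsqrt.mulVec (fun _ => 1) = 0 := by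
    have h0 : (Ginvsqrt.mulVec (fun _ => 1)) ⬝ᵥ (Ginvsqrt.mulVec (fun _ => 1)) = 0 := by
      rw [Matrix.dotProduct_mulVec, ← Matrix.mulVec_transpose, hBt, Matrix.mulVec_mulVec,
        hGinvsqrtSq, hp1, zero_dotProduct]
    exact dotProduct_self_eq_zero.1 h0
  have hsum : ∀ (A : Matrix (Fin J) (Fin J) ℝ) (y : Fin J → ℝ), Aᵀ = A →
      A.mulVec (fun _ => 1) = 0 → ∑ j, A.mulVec y j = 0 := by
    intro A y hA h1
    have : ∑ j, A.mulVec y j = (fun _ => (1 : ℝ)) ⬝ᵥ A.mulVec y := by simp [dotProduct]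
    rw [this, Matrix.dotProduct_mulVec, ← Matrix.mulVec_transpose, hA, h1, zero_dotProduct]
  -- `G * Gpinv` is the identity on `perp`
  have hP : ∀ y ∈ perp J, (G * Gpinv).mulVec y = y := by
    intro y hy
    by_contra hne'
    have hz : y - (G * Gpinv).mulVec y ≠ 0 := fun h => hne' (sub_eq_zero.1 h).symm
    have hzp : y - (G * Gpinv).mulVec y ∈ perp J := by
      have h1 : ∑ j, y j = 0 := hy
      have h2 := hsum G (Gpinv.mulVec y) hGt hG1
      rw [Matrix.mulVec_mulVec] at h2
      show ∑ j, (y - (G * Gpinv).mulVec y) j = 0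
      simp only [Pi.sub_apply, Finset.sum_sub_distrib, h1, h2, sub_zero]
    have h3 := hinv _ hzp hz
    have h4 : G.mulVec (y - (G * Gpinv).mulVec y) = 0 := by
      rw [Matrix.mulVec_sub, Matrix.mulVec_mulVec, hcomm, ← Matrix.mul_assoc, hGpinv1, sub_self]
    rw [h4, dotProduct_zero] at h3
    exact lt_irrefl _ h3
  have hF : 0 ≤ frobSq Gsqrt :=
    Finset.sum_nonneg fun _ _ => Finset.sum_nonneg fun _ _ => sq_nonneg _
  refine ⟨(frobSq Gsqrt + 1) * d, by positivity, fun u hu => ?_⟩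
  set w := Ginvsqrt.mulVec u - vstar with hw
  have hwp : ∑ j, w j = 0 := by
    have h1 : ∑ j, vstar j = 0 := hvstar
    have h2 := hsum Ginvsqrt u hBt hB1
    simp only [hw, Pi.sub_apply, Finset.sum_sub_distrib, h1, h2, sub_zero]
  have hu' : u - Gsqrt.mulVec vstar = Gsqrt.mulVec w := by
    rw [hw, Matrix.mulVec_sub, Matrix.mulVec_mulVec, hAB, hP u hu]
  have hH : Htil J ν c ε μ Ginvsqrt vstar u
      = excess J (fun x => piFun J ν c ε x vstar) ν ε μ w := by
    rw [← hdiff w, hw, add_sub_cancel]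
    rfl
  unfold PhiFun
  rw [hH, hu', mul_assoc]
  have h1 := sqnorm_mulVec_le Gsqrt w
  have h2 := mul_le_mul_of_nonneg_left (hmain w hwp) (by linarith : 0 ≤ frobSq Gsqrt + 1)
  have h3 := sqnorm_nonneg' w
  linarith

end SGNOT

end
end
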